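/- arXiv:math/0703607 — 10 statements merged into one kernel-verified Lean document; each statement's English description precedes it below -/
import Mathlib

section
/- Let λ ∈ (0,1) and for x ∈ [0,1] call a sequence (ε_n)_{n≥1} ∈ {0,1}^ℕ a λ-expansion of x if x = (λ⁻¹ − 1)·∑_{n=1}^∞ ε_n λ^n. If λ > (√5 − 1)/2 (the reciprocal of the golden ratio), then for every x ∈ (0,1) the set of λ-expansions of x has cardinality 2^ℵ₀ (the cardinality of the continuum). -/
namespace LambdaExpansion

/-- The inverse branch of `y ↦ l * y + (1 - l) * d`. -/
noncomputable def branch (l y : ℝ) (d : Fin 2) : ℝ := (y - (1 - l) * (d : ℝ)) / l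

open Classical in
/-- The digit produced at the point `y`: it is forced outside the switch region `(1 - l, l)`,
and read off from `b` inside. -/
noncomputable def digit (l : ℝ) (p : ℝ × (ℕ → Fin 2)) : Fin 2 :=
  if p.1 ≤ 1 - l then 0 else if l ≤ p.1 then 1 else p.2 0

open Classical in
/-- One step of the expansion algorithm; a choice from `b` is consumed in the switch region. -/
noncomputable def step (l : ℝ) (p : ℝ × (ℕ → Fin 2)) : ℝ × (ℕ → Fin 2) :=
  (branch l p.1 (digit l p),
    if p.1 ≤ 1 - l then p.2 else if l ≤ p.1 then p.2 else fun n => p.2 (n + 1))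

/-- The digit sequence generated from `y` by the choices `b`. -/
noncomputable def digits (l y : ℝ) (b : ℕ → Fin 2) (n : ℕ) : Fin 2 :=
  digit l ((step l)^[n] (y, b))

variable {l : ℝ}

lemma step_of_le {y : ℝ} (h : y ≤ 1 - l) (b : ℕ → Fin 2) : step l (y, b) = (y / l, b) := by
  simp [step, digit, branch, h]

lemma step_of_ge {y : ℝ} (h : 1 - l < y) (h' : l ≤ y) (b : ℕ → Fin 2) :
    step l (y, b) = ((y - (1 - l)) / l, b) := by
  simp [step, digit, branch, h.not_ge, h']

lemma digit_switch {y : ℝ} (h : 1 - l < y) (h' : y < l) (b : ℕ → Fin 2) :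
    digit l (y, b) = b 0 := by
  simp [digit, h.not_ge, h'.not_ge]

lemma step_switch {y : ℝ} (h : 1 - l < y) (h' : y < l) (b : ℕ → Fin 2) :
    step l (y, b) = (branch l y (b 0), fun n => b (n + 1)) := by
  simp [step, digit, h.not_ge, h'.not_ge]

lemma branch_switch_mem (h0 : 0 < l) {y : ℝ} (h : 1 - l < y) (h' : y < l) (h1 : l < 1)
    (d : Fin 2) : branch l y d ∈ Set.Ioo (0 : ℝ) 1 := by
  unfold branch
  rw [Set.mem_Ioo, lt_div_iff₀ h0, div_lt_iff₀ h0]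
  fin_cases d <;> constructor <;> simp <;> linarith

lemma step_mem (h0 : 0 < l) (h1 : l < 1) (hl : 1 - l < l ^ 2) {p : ℝ × (ℕ → Fin 2)}
    (hp : p.1 ∈ Set.Ioo (0 : ℝ) 1) : (step l p).1 ∈ Set.Ioo (0 : ℝ) 1 := by
  obtain ⟨y, b⟩ := p
  obtain ⟨hy0, hy1⟩ := hp
  dsimp only at hy0 hy1
  by_cases h : y ≤ 1 - l
  · rw [step_of_le h, Set.mem_Ioo, lt_div_iff₀ h0, div_lt_iff₀ h0]
    constructor <;> nlinarith
  push Not at h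
  by_cases h' : l ≤ y
  · rw [step_of_ge h h', Set.mem_Ioo, lt_div_iff₀ h0, div_lt_iff₀ h0]
    constructor <;> linarith
  push Not at h'
  rw [step_switch h h']
  exact branch_switch_mem h0 h h' h1 _

lemma iterate_mem (h0 : 0 < l) (h1 : l < 1) (hl : 1 - l < l ^ 2) {p : ℝ × (ℕ → Fin 2)}
    (hp : p.1 ∈ Set.Ioo (0 : ℝ) 1) (n : ℕ) : ((step l)^[n] p).1 ∈ Set.Ioo (0 : ℝ) 1 := by
  induction n with
  | zero => exact hp
  | succ n ih =>
    rw [Function.iterate_succ_apply']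
    exact step_mem h0 h1 hl ih

/-- The algorithm started at `y` reaches the switch region before using any choice. -/
def ReachesSwitch (l y : ℝ) : Prop :=
  ∃ N z, 1 - l < z ∧ z < l ∧ ∀ b, (step l)^[N] (y, b) = (z, b)

lemma ReachesSwitch.of_step {y y' : ℝ} (h : ∀ b, step l (y, b) = (y', b))
    (hy' : ReachesSwitch l y') : ReachesSwitch l y := by
  obtain ⟨N, z, hz, hz', hN⟩ := hy'
  exact ⟨N + 1, z, hz, hz', fun b => by rw [Function.iterate_succ_apply, h, hN]⟩

lemma reachesSwitch_of_lt (h0 : 0 < l) (hl : 1 - l < l ^ 2) (k : ℕ) :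
    ∀ y, y < l → (1 - l) * l ^ k < y → ReachesSwitch l y := by
  induction k with
  | zero => exact fun y hy h => ⟨0, y, by simpa using h, hy, fun _ => rfl⟩
  | succ k ih =>
    intro y hy h
    by_cases h' : y ≤ 1 - l
    · refine .of_step (step_of_le h') (ih _ ?_ ?_)
      · rw [div_lt_iff₀ h0]; nlinarith
      · rw [lt_div_iff₀ h0]; rw [pow_succ] at h; linarith
    · exact ⟨0, y, not_le.mp h', hy, fun _ => rfl⟩

lemma reachesSwitch_of_gt (h0 : 0 < l) (hl : 1 - l < l ^ 2) (k : ℕ) :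
    ∀ y, 1 - l < y → (1 - l) * l ^ k < 1 - y → ReachesSwitch l y := by
  induction k with
  | zero => exact fun y hy h => ⟨0, y, hy, by simpa using h, fun _ => rfl⟩
  | succ k ih =>
    intro y hy h
    by_cases h' : l ≤ y
    · refine .of_step (step_of_ge hy h') (ih _ ?_ ?_)
      · rw [lt_div_iff₀ h0]; nlinarith
      · rw [lt_sub_comm, div_lt_iff₀ h0]; rw [pow_succ] at h; linarith
    · exact ⟨0, y, hy, not_le.mp h', fun _ => rfl⟩

lemma reachesSwitch (h0 : 0 < l) (h1 : l < 1) (hl : 1 - l < l ^ 2) {y : ℝ}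
    (hy : y ∈ Set.Ioo (0 : ℝ) 1) : ReachesSwitch l y := by
  have key : ∀ w : ℝ, 0 < w → ∃ k : ℕ, (1 - l) * l ^ k < w := fun w hw => by
    obtain ⟨k, hk⟩ := exists_pow_lt_of_lt_one hw h1
    exact ⟨k, by nlinarith [pow_pos h0 k]⟩
  rcases lt_or_ge y l with h | h
  · obtain ⟨k, hk⟩ := key y hy.1
    exact reachesSwitch_of_lt h0 hl k y h hk
  · obtain ⟨k, hk⟩ := key (1 - y) (by linarith [hy.2])
    exact reachesSwitch_of_gt h0 hl k y (by nlinarith) hk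

lemma eq_of_digits_eq (h0 : 0 < l) (h1 : l < 1) (hl : 1 - l < l ^ 2) (k : ℕ) :
    ∀ y ∈ Set.Ioo (0 : ℝ) 1, ∀ b b', digits l y b = digits l y b' → b k = b' k := by
  induction k with
  | zero =>
    intro y hy b b' h
    obtain ⟨N, z, hz, hz', hN⟩ := reachesSwitch h0 h1 hl hy
    simpa [digits, hN, digit_switch hz hz'] using congrFun h N
  | succ k ih =>
    intro y hy b b' h
    obtain ⟨N, z, hz, hz', hN⟩ := reachesSwitch h0 h1 hl hy
    have hb : b 0 = b' 0 := by
      simpa [digits, hN, digit_switch hz hz'] using congrFun h N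
    refine ih (branch l z (b 0)) (branch_switch_mem h0 hz hz' h1 _)
      (fun n => b (n + 1)) (fun n => b' (n + 1)) (funext fun n => ?_)
    have hn := congrFun h (n + 1 + N)
    simp only [digits, Function.iterate_add_apply _ (n + 1) N, hN, Function.iterate_succ_apply,
      step_switch hz hz', ← hb] at hn
    exact hn

lemma digits_injective (h0 : 0 < l) (h1 : l < 1) (hl : 1 - l < l ^ 2) {y : ℝ}
    (hy : y ∈ Set.Ioo (0 : ℝ) 1) : Function.Injective (digits l y) :=
  fun _ _ h => funext fun k => eq_of_digits_eq h0 h1 hl k y hy _ _ h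

lemma partial_sum_digits (h0 : 0 < l) (y : ℝ) (b : ℕ → Fin 2) (N : ℕ) :
    ∑ n ∈ Finset.range N, (1 - l) * ((digits l y b n : ℝ) * l ^ n) =
      y - l ^ N * ((step l)^[N] (y, b)).1 := by
  induction N with
  | zero => simp
  | succ N ih =>
    rw [Finset.sum_range_succ, ih, Function.iterate_succ_apply']
    simp only [digits, step, branch]
    field_simp
    ring

lemma hasSum_digits (h0 : 0 < l) (h1 : l < 1) (hl : 1 - l < l ^ 2) {y : ℝ}
    (hy : y ∈ Set.Ioo (0 : ℝ) 1) (b : ℕ → Fin 2) :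
    HasSum (fun n => (1 - l) * ((digits l y b n : ℝ) * l ^ n)) y := by
  rw [hasSum_iff_tendsto_nat_of_nonneg
    (fun n => mul_nonneg (by linarith) (mul_nonneg (Nat.cast_nonneg _) (pow_nonneg h0.le n)))]
  simp_rw [partial_sum_digits h0]
  have hpow := tendsto_pow_atTop_nhds_zero_of_lt_one h0.le h1
  have hrem : Filter.Tendsto (fun N => l ^ N * ((step l)^[N] (y, b)).1) Filter.atTop (nhds 0) := by
    refine squeeze_zero (fun N => ?_) (fun N => ?_) hpow
    · exact mul_nonneg (pow_nonneg h0.le N) (iterate_mem h0 h1 hl (p := (y, b)) hy N).1.le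
    · exact mul_le_of_le_one_right (pow_nonneg h0.le N)
        (iterate_mem h0 h1 hl (p := (y, b)) hy N).2.le
  simpa using hrem.const_sub y

lemma eq_tsum_digits (h0 : 0 < l) (h1 : l < 1) (hl : 1 - l < l ^ 2) {y : ℝ}
    (hy : y ∈ Set.Ioo (0 : ℝ) 1) (b : ℕ → Fin 2) :
    y = (l⁻¹ - 1) * ∑' n : ℕ, (digits l y b n : ℝ) * l ^ (n + 1) := by
  rw [← tsum_mul_left]
  refine (hasSum_digits h0 h1 hl hy b).tsum_eq.symm.trans (tsum_congr fun n => ?_)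
  field_simp
  ring

end LambdaExpansion


/-- **Erdős–Joó–Komornik.** If `λ ∈ (0,1)` exceeds the reciprocal of the golden
ratio `(√5 − 1)/2`, then every `x ∈ (0,1)` has a continuum of `λ`-expansions,
i.e. sequences `(ε_n) ∈ {0,1}^ℕ` with `x = (λ⁻¹ − 1) ∑_{n≥1} ε_n λ^n`. -/
theorem stmt0 (lam : ℝ) (h0 : 0 < lam) (h1 : lam < 1)
    (hgolden : (Real.sqrt 5 - 1) / 2 < lam) :
    ∀ x ∈ Set.Ioo (0 : ℝ) 1,
      Cardinal.mk {ε : ℕ → Fin 2 //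
        x = (lam⁻¹ - 1) * ∑' n : ℕ, (ε n : ℝ) * lam ^ (n + 1)} = Cardinal.continuum := by
  intro x hx
  have hl : 1 - lam < lam ^ 2 := by
    nlinarith [Real.sq_sqrt (show (0 : ℝ) ≤ 5 by norm_num), Real.sqrt_nonneg 5]
  have hcard : Cardinal.mk (ℕ → Fin 2) = Cardinal.continuum := by simp
  apply le_antisymm
  · exact hcard ▸ Cardinal.mk_subtype_le _
  · rw [← hcard]
    exact Cardinal.mk_le_of_injective
      (f := fun b => ⟨LambdaExpansion.digits lam x b,
        LambdaExpansion.eq_tsum_digits h0 h1 hl hx b⟩)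
      fun _ _ h => LambdaExpansion.digits_injective h0 h1 hl hx (Subtype.ext_iff.mp h)
end

section
/- Let λ ∈ (1/2, (√5 − 1)/2]. Then for Lebesgue-almost every x ∈ (0,1), the set of sequences (ε_n)_{n≥1} ∈ {0,1}^ℕ with x = (λ⁻¹ − 1)·∑_{n=1}^∞ ε_n λ^n has cardinality 2^ℵ₀ (the cardinality of the continuum). -/
open MeasureTheory

namespace LamExpansion

open Filter Topology Set

/-- The point of `[0, 1]` with address `ε` under the maps `x ↦ l * x` and `x ↦ l * x + (1 - l)`. -/
noncomputable def value (l : ℝ) (ε : ℕ → Fin 2) : ℝ := ∑' n, (1 - l) * (ε n : ℝ) * l ^ n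

/-- The first `n` terms of `value l ε`. -/
noncomputable def partialValue (l : ℝ) (n : ℕ) (ε : ℕ → Fin 2) : ℝ :=
  ∑ k ∈ Finset.range n, (1 - l) * (ε k : ℝ) * l ^ k

/-- The sequence that agrees with `ε` before `n` and continues with `δ` from `n` on. -/
def splice (n : ℕ) (ε δ : ℕ → Fin 2) : ℕ → Fin 2 := fun k => if k < n then ε k else δ (k - n)

variable {l : ℝ}

lemma digit_nonneg (i : Fin 2) : (0 : ℝ) ≤ (i : ℝ) := by positivity

lemma digit_le_one (i : Fin 2) : (i : ℝ) ≤ 1 := by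
  exact_mod_cast Nat.lt_succ_iff.mp i.isLt

lemma term_nonneg (hl0 : 0 < l) (hl1 : l < 1) (i : Fin 2) (n : ℕ) :
    0 ≤ (1 - l) * (i : ℝ) * l ^ n :=
  mul_nonneg (mul_nonneg (by linarith) (digit_nonneg i)) (by positivity)

lemma term_le (hl0 : 0 < l) (hl1 : l < 1) (i : Fin 2) (n : ℕ) :
    (1 - l) * (i : ℝ) * l ^ n ≤ (1 - l) * l ^ n :=
  mul_le_mul_of_nonneg_right (mul_le_of_le_one_right (by linarith) (digit_le_one i))
    (by positivity)

lemma hasSum_geometric_normalized (hl0 : 0 < l) (hl1 : l < 1) :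
    HasSum (fun n : ℕ => (1 - l) * l ^ n) 1 := by
  have h := (hasSum_geometric_of_lt_one hl0.le hl1).mul_left (1 - l)
  rwa [mul_inv_cancel₀ (by linarith)] at h

lemma summable_terms (hl0 : 0 < l) (hl1 : l < 1) (ε : ℕ → Fin 2) :
    Summable fun n => (1 - l) * (ε n : ℝ) * l ^ n :=
  .of_nonneg_of_le (fun n => term_nonneg hl0 hl1 (ε n) n) (fun n => term_le hl0 hl1 (ε n) n)
    (hasSum_geometric_normalized hl0 hl1).summable

lemma value_mem_Icc (hl0 : 0 < l) (hl1 : l < 1) (ε : ℕ → Fin 2) : value l ε ∈ Icc (0 : ℝ) 1 :=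
  ⟨tsum_nonneg fun n => term_nonneg hl0 hl1 (ε n) n,
    hasSum_le (fun n => term_le hl0 hl1 (ε n) n) (summable_terms hl0 hl1 ε).hasSum
      (hasSum_geometric_normalized hl0 hl1)⟩

lemma continuous_partialValue (n : ℕ) : Continuous (partialValue l n) := by
  refine continuous_finsetSum _ fun k _ => ?_
  exact (continuous_of_discreteTopology (f := fun i : Fin 2 => (1 - l) * (i : ℝ) * l ^ k)).comp
    (continuous_apply k)

lemma continuous_value (hl0 : 0 < l) (hl1 : l < 1) : Continuous (value l) := by
  refine continuous_tsum (fun k => ?_) (hasSum_geometric_normalized hl0 hl1).summable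
    fun n ε => ?_
  · exact (continuous_of_discreteTopology (f := fun i : Fin 2 => (1 - l) * (i : ℝ) * l ^ k)).comp
      (continuous_apply k)
  · rw [Real.norm_of_nonneg (term_nonneg hl0 hl1 (ε n) n)]
    exact term_le hl0 hl1 (ε n) n

lemma value_splice (hl0 : 0 < l) (hl1 : l < 1) (n : ℕ) (ε δ : ℕ → Fin 2) :
    value l (splice n ε δ) = partialValue l n ε + l ^ n * value l δ := by
  rw [value, ← (summable_terms hl0 hl1 (splice n ε δ)).sum_add_tsum_nat_add n, value,
    ← tsum_mul_left]
  congr 1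
  · exact Finset.sum_congr rfl fun k hk => by simp [splice, Finset.mem_range.mp hk]
  · refine tsum_congr fun k => ?_
    simp only [splice, not_lt.mpr (Nat.le_add_left n k), if_false, Nat.add_sub_cancel, pow_add]
    ring

lemma splice_shift (n : ℕ) (ε : ℕ → Fin 2) : splice n ε (fun k => ε (k + n)) = ε := by
  funext k
  by_cases h : k < n
  · simp [splice, h]
  · simp [splice, h, Nat.sub_add_cancel (not_lt.mp h)]

lemma splice_add (n : ℕ) (ε δ : ℕ → Fin 2) (k : ℕ) : splice n ε δ (k + n) = δ k := by
  simp [splice]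

lemma value_eq_partialValue_add (hl0 : 0 < l) (hl1 : l < 1) (n : ℕ) (ε : ℕ → Fin 2) :
    value l ε = partialValue l n ε + l ^ n * value l (fun k => ε (k + n)) := by
  rw [← value_splice hl0 hl1, splice_shift]

/-- Every point of `[0, 1]` has an address, given by the lazy algorithm. -/
lemma exists_value_eq (hl : 1 / 2 < l) (hl1 : l < 1) {x : ℝ} (hx : x ∈ Icc (0 : ℝ) 1) :
    ∃ ε, value l ε = x := by
  have hl0 : 0 < l := by linarith
  have step : ∀ y : Icc (0 : ℝ) 1, ∃ (i : Fin 2) (z : Icc (0 : ℝ) 1),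
      (y : ℝ) = (1 - l) * (i : ℝ) + l * z := by
    rintro ⟨y, hy0, hy1⟩
    rcases le_total y l with h | h
    · exact ⟨0, ⟨y / l, div_nonneg hy0 hl0.le, (div_le_one hl0).mpr h⟩, by
        simp; field_simp⟩
    · exact ⟨1, ⟨(y - (1 - l)) / l, div_nonneg (by linarith) hl0.le,
        (div_le_one hl0).mpr (by linarith)⟩, by simp; field_simp; ring⟩
  choose d T hT using step
  let y : ℕ → Icc (0 : ℝ) 1 := fun n => T^[n] ⟨x, hx⟩
  have hy : ∀ n, x = partialValue l n (fun k => d (y k)) + l ^ n * y n := by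
    intro n
    induction n with
    | zero => simp [partialValue, y]
    | succ n ih =>
      have h1 : y (n + 1) = T (y n) := Function.iterate_succ_apply' _ _ _
      have h2 := hT (y n)
      rw [partialValue, Finset.sum_range_succ, ← partialValue, h1, pow_succ]
      rw [h2] at ih
      linear_combination ih
  refine ⟨fun k => d (y k), ?_⟩
  have hlim : Tendsto (fun n => l ^ n * (y n : ℝ)) atTop (𝓝 0) :=
    squeeze_zero (fun n => mul_nonneg (by positivity) (y n).2.1)
      (fun n => mul_le_of_le_one_right (by positivity) (y n).2.2)
      (tendsto_pow_atTop_nhds_zero_of_lt_one hl0.le hl1)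
  have hsum := (summable_terms hl0 hl1 fun k => d (y k)).hasSum.tendsto_sum_nat
  refine tendsto_nhds_unique hsum ?_
  have h : Tendsto (fun n => x - l ^ n * (y n : ℝ)) atTop (𝓝 x) := by
    simpa using hlim.const_sub x
  refine h.congr fun n => ?_
  have := hy n
  simp only [partialValue] at this
  linarith

/-- The points with two addresses that agree before `n` and differ at `n`. -/
def branchSet (l : ℝ) (n : ℕ) : Set ℝ :=
  (fun p : (ℕ → Fin 2) × ℝ => partialValue l n p.1 + l ^ n * p.2) '' (univ ×ˢ Icc (1 - l) l)

/-- The points of `[0, 1]` whose addresses never branch. -/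
def unbranched (l : ℝ) : Set ℝ := Icc 0 1 \ ⋃ n, branchSet l n

lemma measurableSet_unbranched : MeasurableSet (unbranched l) := by
  refine measurableSet_Icc.diff (MeasurableSet.iUnion fun n => ?_)
  refine ((isCompact_univ.prod isCompact_Icc).image ?_).isClosed.measurableSet
  have := continuous_partialValue (l := l) n
  fun_prop

/-- A point of `branchSet l n` has two distinct addresses. -/
lemma exists_ne_of_mem_branchSet (hl : 1 / 2 < l) (hl1 : l < 1) {n : ℕ} {x : ℝ}
    (hx : x ∈ branchSet l n) (ε : ℕ → Fin 2) : ∃ δ, δ ≠ ε ∧ value l δ = x := by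
  have hl0 : 0 < l := by linarith
  obtain ⟨⟨η, s⟩, ⟨-, hs0, hs1⟩, rfl⟩ := hx
  dsimp only at hs0 hs1 ⊢
  have key : ∀ i : Fin 2, ∃ δ, δ n = i ∧ value l δ = partialValue l n η + l ^ n * s := by
    intro i
    have hmem : (s - (1 - l) * (i : ℝ)) / l ∈ Icc (0 : ℝ) 1 := by
      refine ⟨div_nonneg ?_ hl0.le, (div_le_one hl0).mpr ?_⟩ <;> fin_cases i <;> simp <;> linarith
    obtain ⟨δ, hδ⟩ := exists_value_eq hl hl1 hmem
    refine ⟨splice n η (splice 1 (fun _ => i) δ), ?_, ?_⟩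
    · simp [splice]
    · rw [value_splice hl0 hl1, value_splice hl0 hl1, hδ, partialValue.eq_def l 1,
        Finset.sum_range_one, pow_zero, pow_one, mul_one, mul_div_cancel₀ _ hl0.ne', add_sub_cancel]
  obtain ⟨δ, hδ, hv⟩ := key (ε n + 1)
  refine ⟨δ, fun h => ?_, hv⟩
  subst h
  revert hδ
  generalize δ n = i
  fin_cases i <;> simp

lemma volume_unbranched (hl : 1 / 2 < l) (hl1 : l < 1) : volume (unbranched l) = 0 := by
  have hl0 : 0 < l := by linarith
  have hdens := IsUnifLocDoublingMeasure.ae_tendsto_measure_inter_div volume (unbranched l) 1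
  rw [ae_restrict_iff' measurableSet_unbranched] at hdens
  refine measure_mono_null (fun x hxV => ?_) hdens
  simp only [mem_compl_iff, mem_ofPred_eq]
  intro hx
  obtain ⟨ε, rfl⟩ := exists_value_eq hl hl1 hxV.1
  have hpow := tendsto_pow_atTop_nhds_zero_of_lt_one hl0.le hl1
  have hlim := hx hxV (fun n => partialValue l n ε + l ^ n / 2) (fun n => l ^ n / 2)
    (l := atTop) (tendsto_nhdsWithin_iff.mpr ⟨by simpa using hpow.div_const 2,
      Eventually.of_forall fun n => by simp only [mem_Ioi]; positivity⟩)
    (Eventually.of_forall fun n => by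
      have hv := value_mem_Icc hl0 hl1 fun k => ε (k + n)
      have hn : 0 < l ^ n := by positivity
      rw [Real.closedBall_eq_Icc, value_eq_partialValue_add hl0 hl1 n]
      constructor <;> nlinarith [hv.1, hv.2])
  have hle : ∀ n, volume (unbranched l ∩
      Metric.closedBall (partialValue l n ε + l ^ n / 2) (l ^ n / 2)) /
      volume (Metric.closedBall (partialValue l n ε + l ^ n / 2) (l ^ n / 2)) ≤
      ENNReal.ofReal (2 - 2 * l) := by
    intro n
    set p := partialValue l n ε with hp
    have hn : 0 < l ^ n := by positivity
    have hsub : unbranched l ∩ Metric.closedBall (p + l ^ n / 2) (l ^ n / 2) ⊆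
        Icc p (p + l ^ n * (1 - l)) ∪ Icc (p + l ^ n * l) (p + l ^ n) := by
      rintro y ⟨hyV, hyB⟩
      rw [Real.closedBall_eq_Icc] at hyB
      by_contra hy
      simp only [mem_union, mem_Icc, not_or, not_and_or, not_le] at hy
      refine hyV.2 (mem_iUnion.mpr ⟨n, ⟨(ε, (y - p) / l ^ n), ⟨mem_univ _, ?_, ?_⟩, ?_⟩⟩)
      · rw [le_div_iff₀ hn]
        rcases hy.1 with h | h <;> linarith [hyB.1]
      · rw [div_le_iff₀ hn]
        rcases hy.2 with h | h <;> linarith [hyB.2]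
      · simp only [← hp]
        field_simp
        ring
    rw [Real.volume_closedBall]
    refine ENNReal.div_le_of_le_mul ?_
    refine (measure_mono hsub).trans ((measure_union_le _ _).trans (le_of_eq ?_))
    rw [Real.volume_Icc, Real.volume_Icc, ← ENNReal.ofReal_add (by nlinarith) (by nlinarith),
      ← ENNReal.ofReal_mul (by linarith)]
    congr 1
    ring
  have h1 := le_of_tendsto' hlim hle
  rw [ENNReal.one_le_ofReal] at h1
  linarith

/-- The points one of whose addresses has a tail addressing an unbranched point form a null set. -/
lemma ae_tail_notMem_unbranched (hl : 1 / 2 < l) (hl1 : l < 1) :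
    ∀ᵐ x : ℝ, ∀ ε, value l ε = x → ∀ n, value l (fun k => ε (k + n)) ∉ unbranched l := by
  have hl0 : 0 < l := by linarith
  have hnull : volume (⋃ (n : ℕ) (w : Fin n → Fin 2),
      (fun y => ∑ k : Fin n, (1 - l) * (w k : ℝ) * l ^ (k : ℕ) + l ^ n * y) '' unbranched l) = 0 :=
    measure_iUnion_null fun n => measure_iUnion_null fun w =>
      addHaar_image_eq_zero_of_differentiableOn_of_addHaar_eq_zero volume (by fun_prop)
        (volume_unbranched hl hl1)
  filter_upwards [measure_eq_zero_iff_ae_notMem.mp hnull] with x hx ε hε n hn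
  refine hx (mem_iUnion₂.mpr ⟨n, fun k => ε k, _, hn, ?_⟩)
  rw [← hε, value_eq_partialValue_add hl0 hl1 n ε, partialValue, Finset.sum_range]

lemma perfect_addresses (hl : 1 / 2 < l) (hl1 : l < 1) {x : ℝ}
    (hx : ∀ ε, value l ε = x → ∀ n, value l (fun k => ε (k + n)) ∉ unbranched l) :
    Perfect (value l ⁻¹' {x}) := by
  have hl0 : 0 < l := by linarith
  refine ⟨isClosed_singleton.preimage (continuous_value hl0 hl1), fun ε hε => ?_⟩
  have hε : value l ε = x := hε
  have key : ∀ n, ∃ δ, δ ≠ (fun k => ε (k + n)) ∧ value l δ = value l (fun k => ε (k + n)) := by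
    intro n
    have h := hx ε hε n
    simp only [unbranched, Set.mem_sdiff, value_mem_Icc hl0 hl1, true_and, not_not, mem_iUnion] at h
    obtain ⟨m, hm⟩ := h
    exact exists_ne_of_mem_branchSet hl hl1 hm _
  choose δ hne hval using key
  have hlim : Tendsto (fun n => splice n ε (δ n)) atTop (𝓝 ε) :=
    tendsto_pi_nhds.mpr fun k => tendsto_const_nhds.congr' <|
      (eventually_gt_atTop k).mono fun n hn => by simp [splice, hn]
  refine accPt_iff_nhds.mpr fun U hU => ?_
  obtain ⟨n, hn⟩ := (hlim.eventually hU).exists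
  refine ⟨splice n ε (δ n), ⟨hn, ?_⟩, fun h => hne n ?_⟩
  · rw [mem_preimage, mem_singleton_iff, value_splice hl0 hl1, hval,
      ← value_eq_partialValue_add hl0 hl1, hε]
  · funext k
    rw [← splice_add n ε (δ n) k, h]

lemma mk_eq_continuum_of_perfect {C : Set (ℕ → Fin 2)} (hC : Perfect C) (hne : C.Nonempty) :
    Cardinal.mk C = Cardinal.continuum := by
  let _ := TopologicalSpace.upgradeIsCompletelyMetrizable (ℕ → Fin 2)
  obtain ⟨f, hf, -, hinj⟩ := hC.exists_nat_bool_injection hne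
  refine le_antisymm ((Cardinal.mk_set_le C).trans (by simp)) ?_
  have := Cardinal.mk_le_of_injective (f := fun b => (⟨f b, hf ⟨b, rfl⟩⟩ : C))
    fun a b h => hinj (congrArg Subtype.val h)
  simpa using this

end LamExpansion

/-- **Sidorov.** For `λ ∈ (1/2, (√5−1)/2]`, Lebesgue-a.e. `x ∈ (0,1)` has a
continuum of `λ`-expansions `(ε_n) ∈ {0,1}^ℕ` with
`x = (λ⁻¹ − 1) ∑_{n≥1} ε_n λ^n`. -/
theorem stmt1 (lam : ℝ) (h0 : 1 / 2 < lam) (h1 : lam ≤ (Real.sqrt 5 - 1) / 2) :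
    ∀ᵐ x ∂(volume : Measure ℝ), x ∈ Set.Ioo (0 : ℝ) 1 →
      Cardinal.mk {ε : ℕ → Fin 2 //
        x = (lam⁻¹ - 1) * ∑' n : ℕ, (ε n : ℝ) * lam ^ (n + 1)} = Cardinal.continuum := by
  have hl1 : lam < 1 := by
    have : Real.sqrt 5 < 3 := (Real.sqrt_lt' (by norm_num)).mpr (by norm_num)
    linarith
  filter_upwards [LamExpansion.ae_tail_notMem_unbranched h0 hl1] with x hx hx01
  have hvalue : ∀ ε : ℕ → Fin 2,
      (lam⁻¹ - 1) * ∑' n : ℕ, (ε n : ℝ) * lam ^ (n + 1) = LamExpansion.value lam ε := by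
    intro ε
    have hl0 : lam ≠ 0 := by linarith
    rw [LamExpansion.value, ← tsum_mul_left]
    refine tsum_congr fun n => ?_
    rw [pow_succ]
    field_simp
  simp only [hvalue]
  simp only [eq_comm (a := x)]
  exact LamExpansion.mk_eq_continuum_of_perfect (LamExpansion.perfect_addresses h0 hl1 hx)
    (LamExpansion.exists_value_eq h0 hl1 ⟨hx01.1.le, hx01.2.le⟩)
end

section
/- Let d ≥ 1, m ≥ 2, let p_0,…,p_{m−1} ∈ ℝ^d be distinct points whose convex hull Ω is d-dimensional (i.e., Ω has nonempty interior in ℝ^d), let λ ∈ (0,1) and set f_j(x) = λx + (1−λ)p_j. If λ ≥ d/(d+1), then Ω = ⋃_{j=0}^{m−1} f_j(Ω); consequently the attractor S_λ equals Ω, i.e., the attractor has no holes. -/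
open Filter Topology

/-- Carathéodory and pigeonhole: some point of `s` can be assigned weight at least `1 / (d + 1)` in a
convex combination representing a point of the convex hull of `s`. -/
theorem exists_mem_convexHull_eq_smul_add {E : Type*} [NormedAddCommGroup E] [NormedSpace ℝ E]
    [FiniteDimensional ℝ E] {s : Set E} {x : E} (hx : x ∈ convexHull ℝ s) {c : ℝ} (h0 : 0 < c)
    (hc : (Module.finrank ℝ E : ℝ) / (Module.finrank ℝ E + 1) ≤ c) :
    ∃ q ∈ s, ∃ y ∈ convexHull ℝ s, x = c • y + (1 - c) • q := by
  obtain ⟨ι, _, z, w, hz, hind, hw, hw1, rfl⟩ := eq_pos_convex_span_of_mem_convexHull hx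
  have hcard : (Fintype.card ι : ℝ) ≤ Module.finrank ℝ E + 1 := by
    exact_mod_cast hind.card_le_finrank_succ.trans
      (Nat.succ_le_succ (Submodule.finrank_le (vectorSpan ℝ (Set.range z))))
  have hweight : (1 - c) * (Module.finrank ℝ E + 1) ≤ 1 := by
    rw [div_le_iff₀ (by positivity)] at hc
    linarith
  have hne : (Finset.univ : Finset ι).Nonempty := by
    by_contra h
    simp [Finset.not_nonempty_iff_eq_empty.mp h] at hw1
  obtain ⟨j, -, hj⟩ : ∃ j ∈ Finset.univ, 1 - c ≤ w j := by
    refine Finset.exists_le_of_sum_le hne ?_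
    rw [hw1, Finset.sum_const, nsmul_eq_mul, Finset.card_univ]
    nlinarith
  classical
  have hone : ∑ i, (if i = j then 1 - c else 0) = 1 - c := by simp
  have hvec : ∑ i, (if i = j then 1 - c else 0) • z i = (1 - c) • z j := by simp
  refine ⟨z j, hz ⟨j, rfl⟩,
    ∑ i, (c⁻¹ * (w i - if i = j then 1 - c else 0)) • z i, ?_, ?_⟩
  · refine (convex_convexHull ℝ s).sum_mem (fun i _ => ?_) ?_
      fun i _ => subset_convexHull ℝ s (hz ⟨i, rfl⟩)
    · refine mul_nonneg (inv_nonneg.mpr h0.le) (sub_nonneg.mpr ?_)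
      split_ifs with h
      · exact h ▸ hj
      · exact (hw i).le
    · rw [← Finset.mul_sum, Finset.sum_sub_distrib, hw1, hone]
      field_simp
      ring
  · simp_rw [mul_smul, sub_smul]
    rw [← Finset.smul_sum, smul_inv_smul₀ h0.ne', Finset.sum_sub_distrib, hvec]
    module

/-- The finite iterates of the maps `x ↦ c • x + (1 - c) • q n`, applied to any bounded sequence of
starting points, converge to the point with address `q`. -/
theorem tendsto_iterate_similitudes {E : Type*} [NormedAddCommGroup E] [NormedSpace ℝ E]
    [CompleteSpace E] {c : ℝ} (h0 : 0 < c) (h1 : c < 1) {q y : ℕ → E}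
    (hq : Bornology.IsBounded (Set.range q)) (hy : Bornology.IsBounded (Set.range y)) :
    Tendsto (fun N => ∑ n ∈ Finset.range N, ((1 - c) * c ^ n) • q n + c ^ N • y N) atTop
      (𝓝 ((c⁻¹ - 1) • ∑' n, c ^ (n + 1) • q n)) := by
  obtain ⟨C, hC⟩ := hq.exists_norm_le
  obtain ⟨D, hD⟩ := hy.exists_norm_le
  have hnorm : ∀ n, ‖c ^ n‖ = c ^ n := fun n => Real.norm_of_nonneg (pow_nonneg h0.le n)
  have hsum : Summable fun n => c ^ (n + 1) • q n := by
    refine Summable.of_norm_bounded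
      (g := fun n => c ^ n * (c * C)) ((summable_geometric_of_lt_one h0.le h1).mul_right _)
      fun n => ?_
    rw [norm_smul, hnorm, pow_succ, mul_assoc]
    have := hC _ ⟨n, rfl⟩
    gcongr
  have hmain := (hsum.hasSum.const_smul (c⁻¹ - 1)).tendsto_sum_nat
  have htail : Tendsto (fun N => c ^ N • y N) atTop (𝓝 0) := by
    refine squeeze_zero_norm (a := fun N => c ^ N * D) (fun N => ?_) ?_
    · rw [norm_smul, hnorm]
      have := hD _ ⟨N, rfl⟩
      gcongr
    · simpa using (tendsto_pow_atTop_nhds_zero_of_lt_one h0.le h1).mul_const D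
  have hlim := hmain.add htail
  rw [add_zero] at hlim
  refine hlim.congr fun N => ?_
  congr 1
  refine Finset.sum_congr rfl fun n _ => ?_
  rw [smul_smul]
  congr 1
  field_simp
  ring

theorem Convex.iterate_similitudes_mem {E : Type*} [AddCommGroup E] [Module ℝ E] {s : Set E}
    (hs : Convex ℝ s) {c : ℝ} (h0 : 0 < c) (h1 : c < 1) {q : ℕ → E} (hq : ∀ n, q n ∈ s) (N : ℕ)
    {y : E} (hy : y ∈ s) :
    ∑ n ∈ Finset.range N, ((1 - c) * c ^ n) • q n + c ^ N • y ∈ s := by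
  induction N generalizing y with
  | zero => simpa using hy
  | succ N ih =>
    convert ih (hs (hq N) hy (sub_nonneg.mpr h1.le) h0.le (sub_add_cancel 1 c)) using 1
    rw [Finset.sum_range_succ, pow_succ]
    module


/-- If `λ ≥ d/(d+1)`, then the convex hull `Ω` of the points `p_j` satisfies
`Ω = ⋃_j f_j(Ω)`, and consequently the attractor `S_λ` (the set of points
having at least one address) equals `Ω`, i.e. the attractor has no holes. -/
theorem stmt3 (d m : ℕ) (hd : 1 ≤ d) (hm : 2 ≤ m)
    (p : Fin m → EuclideanSpace ℝ (Fin d)) (hp : Function.Injective p)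
    (Ω : Set (EuclideanSpace ℝ (Fin d))) (hΩ : Ω = convexHull ℝ (Set.range p))
    (hint : (interior Ω).Nonempty)
    (lam : ℝ) (h0 : 0 < lam) (h1 : lam < 1)
    (hlam : (d : ℝ) / (d + 1) ≤ lam)
    (f : Fin m → EuclideanSpace ℝ (Fin d) → EuclideanSpace ℝ (Fin d))
    (hf : ∀ j x, f j x = lam • x + (1 - lam) • p j) :
    (Ω = ⋃ j, f j '' Ω) ∧
    ({x : EuclideanSpace ℝ (Fin d) |
      ∃ i : ℕ → Fin m, x = (lam⁻¹ - 1) • ∑' n : ℕ, lam ^ (n + 1) • p (i n)} = Ω) := by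
  have hconv : Convex ℝ Ω := hΩ ▸ convex_convexHull ℝ _
  have hcomp : IsCompact Ω := hΩ ▸ (Set.finite_range p).isCompact_convexHull ℝ
  have hpΩ : ∀ j, p j ∈ Ω := fun j => hΩ ▸ subset_convexHull ℝ _ ⟨j, rfl⟩
  have hbdd : ∀ {u : ℕ → EuclideanSpace ℝ (Fin d)}, (∀ n, u n ∈ Ω) →
      Bornology.IsBounded (Set.range u) :=
    fun hu => hcomp.isBounded.subset (Set.range_subset_iff.mpr hu)
  have hpre : ∀ x : Ω, ∃ (j : Fin m) (y : Ω), (x : EuclideanSpace ℝ (Fin d)) = f j y := by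
    rintro ⟨x, hx⟩
    rw [hΩ] at hx
    obtain ⟨_, ⟨j, rfl⟩, y, hy, hxy⟩ :=
      exists_mem_convexHull_eq_smul_add hx h0 (by simpa using hlam)
    exact ⟨j, ⟨y, hΩ ▸ hy⟩, by rw [hf]; exact hxy⟩
  refine ⟨Set.Subset.antisymm (fun x hx => ?_) ?_, Set.Subset.antisymm ?_ fun x hx => ?_⟩
  · obtain ⟨j, y, hxy⟩ := hpre ⟨x, hx⟩
    exact Set.mem_iUnion.mpr ⟨j, y, y.2, hxy.symm⟩
  · refine Set.iUnion_subset fun j => ?_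
    rintro _ ⟨y, hy, rfl⟩
    rw [hf]
    exact hconv hy (hpΩ j) h0.le (sub_nonneg.mpr h1.le) (add_sub_cancel lam 1)
  · rintro _ ⟨i, rfl⟩
    exact hcomp.isClosed.mem_of_tendsto
      (tendsto_iterate_similitudes h0 h1 (hbdd fun n => hpΩ (i n)) (hbdd fun n => hpΩ (i n)))
      (Eventually.of_forall fun N =>
        hconv.iterate_similitudes_mem h0 h1 (fun n => hpΩ (i n)) N (hpΩ (i N)))
  · choose g y hgy using hpre
    let u : ℕ → Ω := fun n => y^[n] ⟨x, hx⟩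
    have horbit : ∀ N, x = ∑ n ∈ Finset.range N, ((1 - lam) * lam ^ n) • p (g (u n))
        + lam ^ N • (u N : EuclideanSpace ℝ (Fin d)) := by
      intro N
      induction N with
      | zero => simp [u]
      | succ N ih =>
        have hstep : (u N : EuclideanSpace ℝ (Fin d))
            = lam • (u (N + 1) : EuclideanSpace ℝ (Fin d)) + (1 - lam) • p (g (u N)) := by
          rw [← hf]
          simpa only [u, Function.iterate_succ_apply'] using hgy (u N)
        rw [hstep] at ih
        rw [Finset.sum_range_succ, pow_succ]
        refine ih.trans ?_
        module
    refine ⟨fun n => g (u n), tendsto_nhds_unique (tendsto_const_nhds.congr horbit)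
      (tendsto_iterate_similitudes h0 h1 (hbdd fun n => hpΩ _) (hbdd fun n => (u n).2))⟩
end

section
/- Let d ≥ 1 and let p_0,…,p_{k−1} be finitely many points of ℝ^d with convex hull Ω. Then the k sets h_j(Ω), where h_j is the homothety with center p_j and ratio d/(d+1) (i.e., h_j(x) = (d/(d+1))·x + (1/(d+1))·p_j), have a common point: ⋂_{j=0}^{k−1} h_j(Ω) ≠ ∅. -/
/-- A convex combination giving weight at least `1 - r` to `p j` lies in the image of the convex
hull under the homothety with center `p j` and ratio `r`. -/
theorem sum_smul_mem_homothety_image_convexHull {ι E : Type*} [Fintype ι] [AddCommGroup E]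
    [Module ℝ E] (p : ι → E) (w : ι → ℝ) (hw : ∀ i, 0 ≤ w i) (hw_sum : ∑ i, w i = 1)
    {r : ℝ} (hr : 0 < r) (j : ι) (hj : 1 - r ≤ w j) :
    ∑ i, w i • p i ∈ (fun x => r • x + (1 - r) • p j) '' convexHull ℝ (Set.range p) := by
  classical
  let v : ι → ℝ := fun i => r⁻¹ * (w i - if i = j then 1 - r else 0)
  refine ⟨∑ i, v i • p i, ?_, ?_⟩
  · refine (convex_convexHull ℝ _).sum_mem (fun i _ => ?_) ?_
      (fun i _ => subset_convexHull ℝ _ ⟨i, rfl⟩)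
    · refine mul_nonneg (inv_nonneg.2 hr.le) ?_
      split_ifs with hi
      · subst hi
        linarith
      · simpa using hw i
    · simp only [v, ← Finset.mul_sum, Finset.sum_sub_distrib, hw_sum, Finset.sum_ite_eq',
        Finset.mem_univ, if_true]
      field_simp
      ring
  · simp only [v, Finset.smul_sum, smul_smul, mul_inv_cancel_left₀ hr.ne', sub_smul,
      Finset.sum_sub_distrib, ite_smul, zero_smul, Finset.sum_ite_eq', Finset.mem_univ, if_true]
    abel

/-- Helly-type intersection property: for finitely many points `p_0,…,p_{k−1}`
in `ℝ^d` with convex hull `Ω`, the homothetic copies `h_j(Ω)` with centers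
`p_j` and ratio `d/(d+1)` have a common point. -/
theorem stmt4 (d k : ℕ) (hd : 1 ≤ d) (hk : 1 ≤ k)
    (p : Fin k → EuclideanSpace ℝ (Fin d))
    (Ω : Set (EuclideanSpace ℝ (Fin d))) (hΩ : Ω = convexHull ℝ (Set.range p))
    (h : Fin k → EuclideanSpace ℝ (Fin d) → EuclideanSpace ℝ (Fin d))
    (hh : ∀ j x, h j x = ((d : ℝ) / (d + 1)) • x + ((1 : ℝ) / (d + 1)) • p j) :
    (⋂ j, h j '' Ω).Nonempty := by
  classical
  have hd' : (0 : ℝ) < d := by exact_mod_cast hd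
  have hr : 1 - (d : ℝ) / (d + 1) = 1 / (d + 1) := by
    field_simp
    ring
  have h_eq (j : Fin k) :
      h j = fun x => ((d : ℝ) / (d + 1)) • x + (1 - (d : ℝ) / (d + 1)) • p j := by
    funext x
    rw [hh, hr]
  have h_convex (j : Fin k) : Convex ℝ (h j '' Ω) := by
    have h_image : h j '' Ω = (fun x => (1 - (d : ℝ) / (d + 1)) • p j + x) ''
        ((fun x => ((d : ℝ) / (d + 1)) • x) '' Ω) := by
      rw [Set.image_image, h_eq]
      simp only [add_comm]
    rw [h_image, hΩ]
    exact ((convex_convexHull ℝ _).smul _).translate _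
  have h_inter := Convex.helly_theorem' (𝕜 := ℝ) (F := fun j => h j '' Ω) (s := Finset.univ)
    (fun j _ => h_convex j) ?_
  · simpa using h_inter
  intro I _ hI
  rw [finrank_euclideanSpace_fin] at hI
  have hI' : (I.card : ℝ) ≤ d + 1 := by exact_mod_cast hI
  let i₀ : Fin k := ⟨0, hk⟩
  let w : Fin k → ℝ := fun i =>
    ((if i ∈ I then 1 else 0) + (if i = i₀ then (d : ℝ) + 1 - I.card else 0)) / (d + 1)
  have h_extra (i : Fin k) : 0 ≤ if i = i₀ then (d : ℝ) + 1 - I.card else 0 := by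
    split_ifs <;> linarith
  refine ⟨∑ i, w i • p i, Set.mem_iInter₂.2 fun j hj => ?_⟩
  simp only [h_eq, hΩ]
  refine sum_smul_mem_homothety_image_convexHull p w (fun i => ?_) ?_ (by positivity) j ?_
  · refine div_nonneg (add_nonneg ?_ (h_extra i)) (by positivity)
    split_ifs <;> norm_num
  · simp only [w, ← Finset.sum_div, Finset.sum_add_distrib, Finset.sum_ite_eq', Finset.mem_univ,
      if_true, Finset.sum_boole, Finset.filter_univ_mem]
    field_simp
    ring
  · rw [hr]
    simp only [w, hj, if_true]
    gcongr
    linarith [h_extra j]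
end

section
/- Let d ≥ 1, m ≥ 2 and let p_0,…,p_{m−1} ∈ ℝ^d be distinct points whose convex hull Ω has nonempty interior. Then there exists λ_0 < 1 such that for every λ ∈ (λ_0, 1), with f_j(x) = λx + (1−λ)p_j: (1) Ω = ⋃_{j=0}^{m−1} f_j(Ω), i.e., the attractor S_λ equals Ω and has no holes; and (2) every x ∈ Ω that is not a vertex (extreme point) of Ω has exactly 2^ℵ₀ distinct addresses, i.e., the set of addresses of x has the cardinality of the continuum. -/
namespace SelfSimilar

open Set Filter Topology

variable {ι E : Type*}

/-- Prepend a letter to an address. -/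
def consAddr (j : ι) (i : ℕ → ι) : ℕ → ι := fun n => Nat.casesOn n j i

theorem consAddr_injective (j : ι) : Function.Injective (consAddr j) := fun _ _ h =>
  funext fun n => congrFun h (n + 1)

section Normed

variable [NormedAddCommGroup E]

theorem exists_norm_le [Fintype ι] (p : ι → E) : ∃ C, ∀ j, ‖p j‖ ≤ C :=
  ⟨∑ j, ‖p j‖, fun j => Finset.single_le_sum (f := fun j => ‖p j‖)
    (fun _ _ => norm_nonneg _) (Finset.mem_univ j)⟩

variable [NormedSpace ℝ E]

/-- The point with address `i`. -/
noncomputable def point (lam : ℝ) (p : ι → E) (i : ℕ → ι) : E :=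
  (lam⁻¹ - 1) • ∑' n : ℕ, lam ^ (n + 1) • p (i n)

theorem norm_term_le {lam : ℝ} (h0 : 0 < lam) {p : ι → E} {C : ℝ} (hC : ∀ j, ‖p j‖ ≤ C)
    (n : ℕ) (i : ℕ → ι) : ‖lam ^ (n + 1) • p (i n)‖ ≤ lam ^ n * (lam * C) := by
  rw [norm_smul, Real.norm_of_nonneg (by positivity), pow_succ, mul_assoc]
  gcongr
  exact hC _

theorem branch_mem_convexHull {lam : ℝ} (h0 : 0 < lam) (h1 : lam < 1) (p : ι → E) (j : ι)
    {x : E} (hx : x ∈ convexHull ℝ (range p)) :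
    lam • x + (1 - lam) • p j ∈ convexHull ℝ (range p) :=
  convex_convexHull ℝ _ hx (subset_convexHull ℝ _ (mem_range_self j)) h0.le
    (sub_nonneg.2 h1.le) (by ring)

theorem partialSum_add_mem_convexHull {lam : ℝ} (h0 : 0 < lam) (h1 : lam < 1) (p : ι → E)
    {x : E} (hx : x ∈ convexHull ℝ (range p)) (n : ℕ) : ∀ i : ℕ → ι,
    lam ^ n • x + ∑ k ∈ Finset.range n, ((1 - lam) * lam ^ k) • p (i k) ∈
      convexHull ℝ (range p) := by
  induction n with
  | zero => exact fun _ => by simpa using hx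
  | succ n ih =>
    intro i
    convert! branch_mem_convexHull h0 h1 p (i 0) (ih fun k => i (k + 1)) using 1
    rw [Finset.sum_range_succ']
    simp only [smul_add, smul_smul, Finset.smul_sum, pow_succ', pow_zero, mul_one, add_assoc]
    simp only [mul_left_comm]

variable [Fintype ι]

theorem summable_bound {lam : ℝ} (h0 : 0 < lam) (h1 : lam < 1) (C : ℝ) :
    Summable fun n : ℕ => lam ^ n * (lam * C) :=
  (summable_geometric_of_lt_one h0.le h1).mul_right _

theorem continuous_point [CompleteSpace E] [TopologicalSpace ι] [DiscreteTopology ι] {lam : ℝ}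
    (h0 : 0 < lam) (h1 : lam < 1) (p : ι → E) : Continuous (point lam p) := by
  obtain ⟨C, hC⟩ := exists_norm_le p
  refine (continuous_tsum (fun n => ?_) (summable_bound h0 h1 C)
    fun n i => norm_term_le h0 hC n i).const_smul _
  exact ((continuous_of_discreteTopology (f := p)).comp (continuous_apply n)).const_smul _

theorem tendsto_point [CompleteSpace E] {lam : ℝ} (h0 : 0 < lam) (h1 : lam < 1) (p : ι → E)
    (i : ℕ → ι) :
    Tendsto (fun n => ∑ k ∈ Finset.range n, ((1 - lam) * lam ^ k) • p (i k)) atTop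
      (𝓝 (point lam p i)) := by
  obtain ⟨C, hC⟩ := exists_norm_le p
  have hs : Summable fun n : ℕ => lam ^ (n + 1) • p (i n) :=
    Summable.of_norm_bounded (summable_bound h0 h1 C) fun n => norm_term_le h0 hC n i
  convert! (hs.hasSum.tendsto_sum_nat.const_smul (lam⁻¹ - 1)) using 2 with n
  rw [Finset.smul_sum]
  refine Finset.sum_congr rfl fun k _ => ?_
  rw [smul_smul]
  congr 1
  field_simp
  ring

theorem tendsto_pow_smul_of_bounded {lam : ℝ} (h0 : 0 < lam) (h1 : lam < 1) {p : ι → E}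
    {w : ℕ → ι → ℝ} (hw : ∀ n, w n ∈ stdSimplex ℝ ι) :
    Tendsto (fun n => lam ^ n • Fintype.linearCombination ℝ p (w n)) atTop (𝓝 0) := by
  obtain ⟨C, hC⟩ := exists_norm_le p
  refine squeeze_zero_norm (a := fun n => lam ^ n * C) (fun n => ?_) (by
    simpa using (tendsto_pow_atTop_nhds_zero_of_lt_one h0.le h1).mul_const C)
  rw [norm_smul, Real.norm_of_nonneg (by positivity)]
  gcongr
  rw [Fintype.linearCombination_apply]
  calc ‖∑ j, w n j • p j‖ ≤ ∑ j, w n j * C := norm_sum_le_of_le _ fun j _ => by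
        rw [norm_smul, Real.norm_of_nonneg ((hw n).1 j)]
        exact mul_le_mul_of_nonneg_left (hC j) ((hw n).1 j)
    _ = C := by rw [← Finset.sum_mul, (hw n).2, one_mul]

theorem point_mem_convexHull [CompleteSpace E] {lam : ℝ} (h0 : 0 < lam) (h1 : lam < 1)
    (p : ι → E) (i : ℕ → ι) : point lam p i ∈ convexHull ℝ (range p) := by
  have hx : p (i 0) ∈ convexHull ℝ (range p) := subset_convexHull ℝ _ (mem_range_self _)
  refine ((finite_range p).isClosed_convexHull ℝ).mem_of_tendsto (b := atTop) ?_
    (Eventually.of_forall fun n => partialSum_add_mem_convexHull h0 h1 p hx n i)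
  simpa using ((tendsto_pow_atTop_nhds_zero_of_lt_one h0.le h1).smul_const (p (i 0))).add
    (tendsto_point h0 h1 p i)

end Normed

section Weights

variable [Fintype ι]

/-- Points of the standard simplex that are not vertices. -/
def nonvertex (ι : Type*) [Fintype ι] : Set (ι → ℝ) :=
  {w | w ∈ stdSimplex ℝ ι ∧ ∃ j k, j ≠ k ∧ 0 < w j ∧ 0 < w k}

theorem exists_weight_lt {u v : ι → ℝ} (hu : u ∈ stdSimplex ℝ ι) (hv : v ∈ stdSimplex ℝ ι)
    (h : u ≠ v) : ∃ j, u j < v j := by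
  by_contra! hc
  refine h (funext fun j => ?_)
  exact ((Finset.sum_eq_sum_iff_of_le fun k _ => hc k).1 (hv.2.trans hu.2.symm) j
    (Finset.mem_univ j)).symm

theorem exists_max_weight {w : ι → ℝ} (hw : w ∈ stdSimplex ℝ ι) :
    ∃ j, 1 ≤ Fintype.card ι * w j := by
  have : Nonempty ι := by
    by_contra h
    rw [not_nonempty_iff] at h
    simpa using hw.2
  obtain ⟨j, hj⟩ := Finite.exists_max w
  refine ⟨j, ?_⟩
  rw [← hw.2, ← nsmul_eq_mul]
  exact Finset.sum_le_card_nsmul _ _ _ fun k _ => hj k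

/-- The contraction ratio is large enough for the largest weight always to be usable, even
compared with a weight which has just outgrown `1 - lam`. -/
def LargeRatio (ι : Type*) [Fintype ι] (lam : ℝ) : Prop :=
  0 < lam ∧ lam < 1 ∧ Fintype.card ι * (1 - lam) < lam

theorem LargeRatio.lt_of_max {lam : ℝ} (h : LargeRatio ι lam) {a : ℝ}
    (ha : 1 ≤ Fintype.card ι * a) : 1 - lam < a := by
  obtain ⟨h0, h1, h2⟩ := h
  by_contra! hc
  have := mul_le_mul_of_nonneg_left hc (Nat.cast_nonneg (α := ℝ) (Fintype.card ι))
  linarith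

theorem exists_max_and_pos {w : ι → ℝ} (hw : w ∈ nonvertex ι) :
    ∃ j k, k ≠ j ∧ 1 ≤ Fintype.card ι * w j ∧ 0 < w k := by
  obtain ⟨hs, a, b, hab, ha, hb⟩ := hw
  obtain ⟨j, hj⟩ := exists_max_weight hs
  by_cases h : a = j
  · exact ⟨j, b, fun hbj => hab (h.trans hbj.symm), hj, hb⟩
  · exact ⟨j, a, h, hj, ha⟩

end Weights

section Pull

variable [DecidableEq ι]

/-- The inverse branch `w ↦ (w - (1 - lam) eⱼ) / lam` acting on barycentric weights. -/
noncomputable def pull (lam : ℝ) (j : ι) (w : ι → ℝ) : ι → ℝ :=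
  lam⁻¹ • (w - (1 - lam) • Pi.single j 1)

/-- The weights left after `n` inverse branches, taken in the order given by the address `i`. -/
noncomputable def iterPull (lam : ℝ) : ℕ → (ι → ℝ) → (ℕ → ι) → ι → ℝ
  | 0, w, _ => w
  | n + 1, w, i => iterPull lam n (pull lam (i 0) w) (fun k => i (k + 1))

/-- Addresses along which the weights always stay in `G`. -/
def staying (lam : ℝ) (G : Set (ι → ℝ)) (w : ι → ℝ) : Set (ℕ → ι) :=
  {i | ∀ n, iterPull lam n w i ∈ G}

theorem consAddr_mem_staying {lam : ℝ} {G : Set (ι → ℝ)} {w : ι → ℝ} (hw : w ∈ G) {j : ι}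
    {i : ℕ → ι} (hi : i ∈ staying lam G (pull lam j w)) : consAddr j i ∈ staying lam G w := by
  rintro (_ | n)
  exacts [hw, hi n]

theorem tail_mem_staying {lam : ℝ} {G : Set (ι → ℝ)} {w : ι → ℝ} {i : ℕ → ι}
    (hi : i ∈ staying lam G w) :
    (fun k => i (k + 1)) ∈ staying lam G (pull lam (i 0) w) := fun n => hi (n + 1)

theorem pull_apply_self {lam : ℝ} (j : ι) (w : ι → ℝ) :
    pull lam j w j = lam⁻¹ * (w j - (1 - lam)) := by simp [pull]

theorem pull_apply_of_ne {lam : ℝ} {j k : ι} (h : k ≠ j) (w : ι → ℝ) :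
    pull lam j w k = lam⁻¹ * w k := by simp [pull, h]

theorem staying_nonempty {lam : ℝ} {G : Set (ι → ℝ)}
    (hG : ∀ w ∈ G, ∃ j, pull lam j w ∈ G) {w : ι → ℝ} (hw : w ∈ G) :
    (staying lam G w).Nonempty := by
  have : Nonempty ι := ⟨(hG w hw).choose⟩
  choose! J hJ using hG
  let T : (ι → ℝ) → ι → ℝ := fun w => pull lam (J w) w
  have key : ∀ n w, iterPull lam n w (fun k => J (T^[k] w)) = T^[n] w := by
    intro n
    induction n with
    | zero => exact fun _ => rfl
    | succ n ih => exact fun w => ih (T w)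
  refine ⟨fun k => J (T^[k] w), fun n => ?_⟩
  rw [key]
  induction n with
  | zero => exact hw
  | succ n ih =>
    rw [Function.iterate_succ_apply']
    exact hJ _ ih

end Pull

variable [Fintype ι] [DecidableEq ι] [NormedAddCommGroup E] [NormedSpace ℝ E]

theorem pull_mem_stdSimplex {lam : ℝ} (hl : 0 < lam) {j : ι} {w : ι → ℝ}
    (hw : w ∈ stdSimplex ℝ ι) (hj : 1 - lam ≤ w j) : pull lam j w ∈ stdSimplex ℝ ι := by
  refine ⟨fun k => ?_, ?_⟩
  · by_cases h : k = j
    · subst h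
      rw [pull_apply_self]
      exact mul_nonneg (inv_nonneg.2 hl.le) (sub_nonneg.2 hj)
    · rw [pull_apply_of_ne h]
      exact mul_nonneg (inv_nonneg.2 hl.le) (hw.1 k)
  · simp only [pull, Pi.smul_apply, Pi.sub_apply, smul_eq_mul, ← Finset.mul_sum,
      Finset.sum_sub_distrib, hw.2, Finset.sum_pi_single', Finset.mem_univ, if_true]
    simp [hl.ne']

theorem pull_mem_nonvertex {lam : ℝ} (hl : 0 < lam) {j k : ι} {w : ι → ℝ}
    (hw : w ∈ stdSimplex ℝ ι) (hj : 1 - lam < w j) (hkj : k ≠ j) (hk : 0 < w k) :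
    pull lam j w ∈ nonvertex ι := by
  refine ⟨pull_mem_stdSimplex hl hw hj.le, k, j, hkj, ?_, ?_⟩
  · rw [pull_apply_of_ne hkj]
    positivity
  · rw [pull_apply_self]
    exact mul_pos (inv_pos.2 hl) (sub_pos.2 hj)

theorem LargeRatio.exists_pull_mem_stdSimplex {lam : ℝ} (h : LargeRatio ι lam) :
    ∀ w ∈ stdSimplex ℝ ι, ∃ j, pull lam j w ∈ stdSimplex ℝ ι := fun _ hw =>
  let ⟨j, hj⟩ := exists_max_weight hw
  ⟨j, pull_mem_stdSimplex h.1 hw (h.lt_of_max hj).le⟩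

theorem LargeRatio.exists_pull_mem_nonvertex {lam : ℝ} (h : LargeRatio ι lam) :
    ∀ w ∈ nonvertex ι, ∃ j, pull lam j w ∈ nonvertex ι := fun _ hw =>
  let ⟨j, _, hkj, hj, hk⟩ := exists_max_and_pos hw
  ⟨j, pull_mem_nonvertex h.1 hw.1 (h.lt_of_max hj) hkj hk⟩

theorem LargeRatio.nontrivial_of_two_choices {lam : ℝ} (h : LargeRatio ι lam) {w : ι → ℝ}
    (hw : w ∈ nonvertex ι) {j k : ι} (hkj : k ≠ j) (hj : 1 - lam < w j) (hk : 1 - lam < w k) :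
    (staying lam (nonvertex ι) w).Nontrivial := by
  have h1 : 0 < 1 - lam := sub_pos.2 h.2.1
  obtain ⟨a, ha⟩ := staying_nonempty h.exists_pull_mem_nonvertex
    (pull_mem_nonvertex h.1 hw.1 hj hkj (h1.trans hk))
  obtain ⟨b, hb⟩ := staying_nonempty h.exists_pull_mem_nonvertex
    (pull_mem_nonvertex h.1 hw.1 hk hkj.symm (h1.trans hj))
  exact ⟨_, consAddr_mem_staying hw ha, _, consAddr_mem_staying hw hb,
    fun hab => hkj (congrFun hab 0).symm⟩

theorem LargeRatio.nontrivial_of_small_weight {lam : ℝ} (h : LargeRatio ι lam) (k : ι) (n : ℕ) :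
    ∀ w ∈ nonvertex ι, 0 < w k → Fintype.card ι * w k < 1 → 1 - lam < w k * (lam⁻¹) ^ n →
      (staying lam (nonvertex ι) w).Nontrivial := by
  induction n with
  | zero =>
    intro w hw _ hk1 hk2
    obtain ⟨j, hj⟩ := exists_max_weight hw.1
    refine h.nontrivial_of_two_choices hw ?_ (h.lt_of_max hj) (by simpa using hk2)
    rintro rfl
    exact hk1.not_ge hj
  | succ n ih =>
    intro w hw hk hk1 hk2
    obtain ⟨j, hj⟩ := exists_max_weight hw.1
    have hkj : k ≠ j := by
      rintro rfl
      exact hk1.not_ge hj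
    by_cases hc : 1 - lam < w k
    · exact h.nontrivial_of_two_choices hw hkj (h.lt_of_max hj) hc
    have hkp := pull_apply_of_ne (lam := lam) hkj w
    have hl := h.1
    refine ((ih (pull lam j w) (pull_mem_nonvertex hl hw.1 (h.lt_of_max hj) hkj hk)
      (by rw [hkp]; positivity) ?_ ?_).image (consAddr_injective j)).mono ?_
    · have h2 := mul_le_mul_of_nonneg_left (not_lt.1 hc)
        (Nat.cast_nonneg (α := ℝ) (Fintype.card ι))
      rw [hkp, mul_left_comm, inv_mul_lt_iff₀ hl, mul_one]
      exact h2.trans_lt h.2.2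
    · rw [hkp]
      convert! hk2 using 1
      ring
    · rintro _ ⟨i, hi, rfl⟩
      exact consAddr_mem_staying hw hi

theorem LargeRatio.staying_nontrivial {lam : ℝ} (h : LargeRatio ι lam) {w : ι → ℝ}
    (hw : w ∈ nonvertex ι) : (staying lam (nonvertex ι) w).Nontrivial := by
  obtain ⟨j, k, hkj, hj, hk⟩ := exists_max_and_pos hw
  by_cases hk1 : Fintype.card ι * w k < 1
  · obtain ⟨n, hn⟩ := pow_unbounded_of_one_lt ((1 - lam) / w k) ((one_lt_inv₀ h.1).2 h.2.1)
    refine h.nontrivial_of_small_weight k n w hw hk hk1 ?_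
    rwa [div_lt_iff₀' hk] at hn
  · exact h.nontrivial_of_two_choices hw hkj (h.lt_of_max hj) (h.lt_of_max (not_lt.1 hk1))

theorem LargeRatio.exists_ne_agreeing {lam : ℝ} (h : LargeRatio ι lam) (N : ℕ) :
    ∀ (w : ι → ℝ), ∀ i ∈ staying lam (nonvertex ι) w,
      ∃ i' ∈ staying lam (nonvertex ι) w, i' ≠ i ∧ ∀ n < N, i' n = i n := by
  induction N with
  | zero =>
    intro w i hi
    obtain ⟨i', hi', hne⟩ := (h.staying_nontrivial (hi 0)).exists_ne i
    exact ⟨i', hi', hne, fun n hn => absurd hn (Nat.not_lt_zero n)⟩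
  | succ N ih =>
    intro w i hi
    obtain ⟨i', hi', hne, hag⟩ := ih _ _ (tail_mem_staying hi)
    refine ⟨consAddr (i 0) i', consAddr_mem_staying (hi 0) hi', fun he => hne ?_, ?_⟩
    · exact funext fun n => congrFun he (n + 1)
    · rintro (_ | n) hn
      exacts [rfl, hag n (by omega)]

theorem LargeRatio.preperfect_staying [TopologicalSpace ι] [DiscreteTopology ι] {lam : ℝ}
    (h : LargeRatio ι lam) (w : ι → ℝ) : Preperfect (staying lam (nonvertex ι) w) := by
  rw [preperfect_iff_nhds]
  intro i hi U hU
  obtain ⟨_, ⟨x, n, rfl⟩, hix, hxU⟩ :=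
    (PiNat.isTopologicalBasis_cylinders (fun _ : ℕ => ι)).mem_nhds_iff.1 hU
  obtain ⟨i', hi', hne, hag⟩ := h.exists_ne_agreeing n w i hi
  refine ⟨i', ⟨hxU ?_, hi'⟩, hne⟩
  rw [PiNat.mem_cylinder_iff] at hix ⊢
  exact fun k hk => (hag k hk).trans (hix k hk)

theorem linearCombination_pull {lam : ℝ} (hl : lam ≠ 0) (p : ι → E) (j : ι) (w : ι → ℝ) :
    Fintype.linearCombination ℝ p w =
      lam • Fintype.linearCombination ℝ p (pull lam j w) + (1 - lam) • p j := by
  simp [pull, smul_smul, hl, smul_sub]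

theorem linearCombination_iterPull {lam : ℝ} (hl : lam ≠ 0) (p : ι → E) (n : ℕ) :
    ∀ (w : ι → ℝ) (i : ℕ → ι), Fintype.linearCombination ℝ p w =
      lam ^ n • Fintype.linearCombination ℝ p (iterPull lam n w i) +
        ∑ k ∈ Finset.range n, ((1 - lam) * lam ^ k) • p (i k) := by
  induction n with
  | zero => simp [iterPull]
  | succ n ih =>
    intro w i
    rw [linearCombination_pull hl p (i 0) w, ih _ (fun k => i (k + 1)), Finset.sum_range_succ']
    simp only [iterPull, smul_add, smul_smul, Finset.smul_sum, pow_succ', pow_zero, mul_one,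
      add_assoc]
    simp only [mul_left_comm]

theorem eq_point_of_mem_staying [CompleteSpace E] {lam : ℝ} (h0 : 0 < lam) (h1 : lam < 1)
    (p : ι → E) {w : ι → ℝ} {i : ℕ → ι} (hi : i ∈ staying lam (stdSimplex ℝ ι) w) :
    Fintype.linearCombination ℝ p w = point lam p i := by
  refine tendsto_nhds_unique (tendsto_const_nhds (f := (atTop : Filter ℕ))) ?_
  have := (tendsto_pow_smul_of_bounded h0 h1 (p := p) hi).add (tendsto_point h0 h1 p i)
  simpa only [← linearCombination_iterPull h0.ne' p, zero_add] using this

theorem convexHull_eq_image (p : ι → E) :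
    convexHull ℝ (range p) = Fintype.linearCombination ℝ p '' stdSimplex ℝ ι := by
  rw [← convexHull_rangle_single_eq_stdSimplex, LinearMap.image_convexHull, ← range_comp]
  congr 2
  ext j
  simp

theorem exists_nonvertex_of_notMem_extremePoints {p : ι → E} {x : E}
    (hx : x ∈ convexHull ℝ (range p)) (hx' : x ∉ (convexHull ℝ (range p)).extremePoints ℝ) :
    ∃ w ∈ nonvertex ι, Fintype.linearCombination ℝ p w = x := by
  rw [mem_extremePoints] at hx'
  push Not at hx'
  obtain ⟨y, hy, z, hz, ⟨a, b, ha, hb, hab, rfl⟩, hne⟩ := hx' hx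
  rw [convexHull_eq_image] at hy hz
  obtain ⟨u, hu, rfl⟩ := hy
  obtain ⟨v, hv, rfl⟩ := hz
  have huv : u ≠ v := by
    rintro rfl
    have hx : a • Fintype.linearCombination ℝ p u + b • Fintype.linearCombination ℝ p u =
        Fintype.linearCombination ℝ p u := by rw [← add_smul, hab, one_smul]
    exact hne hx.symm hx.symm
  obtain ⟨j, hj⟩ := exists_weight_lt hu hv huv
  obtain ⟨k, hk⟩ := exists_weight_lt hv hu huv.symm
  refine ⟨a • u + b • v, ⟨convex_stdSimplex ℝ ι hu hv ha.le hb.le hab, j, k, ?_, ?_, ?_⟩, ?_⟩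
  · rintro rfl
    exact hj.not_gt hk
  · exact add_pos_of_nonneg_of_pos (mul_nonneg ha.le (hu.1 j)) (mul_pos hb ((hu.1 j).trans_lt hj))
  · exact add_pos_of_pos_of_nonneg (mul_pos ha ((hv.1 k).trans_lt hk)) (mul_nonneg hb.le (hv.1 k))
  · rw [map_add, map_smul, map_smul]

theorem LargeRatio.mk_addresses {κ : Type} [Fintype κ] [DecidableEq κ]
    [TopologicalSpace κ] [DiscreteTopology κ] [CompleteSpace E]
    {lam : ℝ} (h : LargeRatio κ lam) (p : κ → E) {w : κ → ℝ} (hw : w ∈ nonvertex κ) :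
    Cardinal.mk {i : ℕ → κ // Fintype.linearCombination ℝ p w = point lam p i} =
      Cardinal.continuum := by
  apply le_antisymm
  · calc Cardinal.mk {i : ℕ → κ // Fintype.linearCombination ℝ p w = point lam p i}
        ≤ Cardinal.mk (ℕ → κ) := Cardinal.mk_subtype_le _
      _ ≤ Cardinal.mk (ℕ → ℕ) :=
        Cardinal.mk_le_of_injective (f := fun i n => (Fintype.equivFin κ (i n) : ℕ)) fun i i' hi =>
          funext fun n => (Fintype.equivFin κ).injective (Fin.ext (congrFun hi n))
      _ = Cardinal.continuum := by simp
  · let := TopologicalSpace.upgradeIsCompletelyMetrizable (ℕ → κ)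
    obtain ⟨f, hf, -, hinj⟩ :=
      (h.preperfect_staying w).perfect_closure.exists_nat_bool_injection
        (h.staying_nontrivial hw).nonempty.closure
    have hsub : closure (staying lam (nonvertex κ) w) ⊆
        {i | Fintype.linearCombination ℝ p w = point lam p i} :=
      closure_minimal (fun i hi => eq_point_of_mem_staying h.1 h.2.1 p fun n => (hi n).1)
        (isClosed_eq continuous_const (continuous_point h.1 h.2.1 p))
    have hle := Cardinal.mk_le_of_injective (f := fun b =>
      (⟨f b, hsub (hf (mem_range_self b))⟩ :
        {i : ℕ → κ // Fintype.linearCombination ℝ p w = point lam p i}))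
      fun a b hab => hinj (congrArg Subtype.val hab)
    simpa using hle

end SelfSimilar

open SelfSimilar

/-- For any distinct points `p_0,…,p_{m−1}` spanning `ℝ^d` there exists
`λ_0 < 1` such that for every `λ ∈ (λ_0, 1)`: (1) the attractor has no holes,
i.e. `S_λ = Ω = ⋃_j f_j(Ω)`; (2) every non-vertex point of `Ω` has a continuum
of distinct addresses. -/
theorem stmt6 (d m : ℕ) (hd : 1 ≤ d) (hm : 2 ≤ m)
    (p : Fin m → EuclideanSpace ℝ (Fin d)) (hp : Function.Injective p)
    (Ω : Set (EuclideanSpace ℝ (Fin d))) (hΩ : Ω = convexHull ℝ (Set.range p))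
    (hint : (interior Ω).Nonempty) :
    ∃ lam0 : ℝ, 0 < lam0 ∧ lam0 < 1 ∧ ∀ lam : ℝ, lam0 < lam → lam < 1 →
      (Ω = ⋃ j, (fun x => lam • x + (1 - lam) • p j) '' Ω) ∧
      ({x : EuclideanSpace ℝ (Fin d) |
        ∃ i : ℕ → Fin m, x = (lam⁻¹ - 1) • ∑' n : ℕ, lam ^ (n + 1) • p (i n)} = Ω) ∧
      ∀ x ∈ Ω, x ∉ Set.extremePoints ℝ Ω →
        Cardinal.mk {i : ℕ → Fin m //
          x = (lam⁻¹ - 1) • ∑' n : ℕ, lam ^ (n + 1) • p (i n)} = Cardinal.continuum := by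
  subst hΩ
  have hm0 : (0 : ℝ) < m := by exact_mod_cast (by omega : 0 < m)
  refine ⟨m / (m + 1), by positivity, (div_lt_one (by positivity)).2 (by linarith), ?_⟩
  intro lam h0 h1
  have hl0 : 0 < lam := lt_trans (by positivity) h0
  have h : LargeRatio (Fin m) lam := by
    refine ⟨hl0, h1, ?_⟩
    rw [div_lt_iff₀ (by positivity)] at h0
    rw [Fintype.card_fin]
    linarith
  refine ⟨?_, ?_, ?_⟩
  · apply Set.Subset.antisymm
    · intro x hx
      rw [convexHull_eq_image] at hx ⊢
      obtain ⟨w, hw, rfl⟩ := hx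
      obtain ⟨j, hj⟩ := h.exists_pull_mem_stdSimplex w hw
      exact Set.mem_iUnion.2 ⟨j, _, ⟨_, hj, rfl⟩, (linearCombination_pull hl0.ne' p j w).symm⟩
    · refine Set.iUnion_subset fun j => ?_
      rintro _ ⟨x, hx, rfl⟩
      exact branch_mem_convexHull hl0 h1 p j hx
  · apply Set.Subset.antisymm
    · rintro _ ⟨i, rfl⟩
      exact point_mem_convexHull hl0 h1 p i
    · intro x hx
      rw [convexHull_eq_image] at hx
      obtain ⟨w, hw, rfl⟩ := hx
      obtain ⟨i, hi⟩ := staying_nonempty h.exists_pull_mem_stdSimplex hw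
      exact ⟨i, eq_point_of_mem_staying hl0 h1 p hi⟩
  · intro x hx hx'
    obtain ⟨w, hw, rfl⟩ := exists_nonvertex_of_notMem_extremePoints hx hx'
    exact h.mk_addresses p hw
end

section
/- Let d ≥ 1, m ≥ 2, distinct points p_0,…,p_{m−1} ∈ ℝ^d, λ ∈ (0,1), and f_j(x) = λx + (1−λ)p_j. Let U_λ be the set of points of the attractor S_λ having exactly one address, and V_λ = { x ∈ S_λ : the set of addresses of x has cardinality strictly less than 2^ℵ₀ }. Then the Hausdorff dimensions coincide: dim_H V_λ = dim_H U_λ. -/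
/-- The point with address `i`: the normalised power series `(lam⁻¹ - 1) ∑ lam ^ n p_{i_n}`. -/
noncomputable def addressPoint {m d : ℕ} (p : Fin m → EuclideanSpace ℝ (Fin d)) (lam : ℝ)
    (i : ℕ → Fin m) : EuclideanSpace ℝ (Fin d) :=
  (lam⁻¹ - 1) • ∑' n : ℕ, lam ^ (n + 1) • p (i n)

section

variable {m d : ℕ} (p : Fin m → EuclideanSpace ℝ (Fin d)) {lam : ℝ}

theorem norm_address_term_le (h0 : 0 < lam) (n : ℕ) (j : Fin m) :
    ‖lam ^ (n + 1) • p j‖ ≤ lam ^ n * (lam * ∑ k, ‖p k‖) := by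
  rw [norm_smul, Real.norm_of_nonneg (by positivity), pow_succ, mul_assoc]
  gcongr
  exact Finset.single_le_sum (f := fun k => ‖p k‖) (fun _ _ => norm_nonneg _) (Finset.mem_univ j)

theorem summable_address_bound (h0 : 0 < lam) (h1 : lam < 1) :
    Summable fun n : ℕ => lam ^ n * (lam * ∑ k, ‖p k‖) :=
  (summable_geometric_of_lt_one h0.le h1).mul_right _

theorem summable_address (h0 : 0 < lam) (h1 : lam < 1) (i : ℕ → Fin m) :
    Summable fun n : ℕ => lam ^ (n + 1) • p (i n) :=
  (summable_address_bound p h0 h1).of_norm_bounded fun n => norm_address_term_le p h0 n (i n)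

theorem continuous_addressPoint (h0 : 0 < lam) (h1 : lam < 1) :
    Continuous (addressPoint p lam) := by
  have h (n : ℕ) : Continuous fun i : ℕ → Fin m => lam ^ (n + 1) • p (i n) :=
    (continuous_of_discreteTopology (f := fun j : Fin m => lam ^ (n + 1) • p j)).comp
      (continuous_apply n)
  have hsum : Continuous fun i : ℕ → Fin m => ∑' n : ℕ, lam ^ (n + 1) • p (i n) :=
    continuous_tsum h (summable_address_bound p h0 h1)
      fun n i => norm_address_term_le p h0 n (i n)
  exact hsum.const_smul (lam⁻¹ - 1)

/-- The composition of the similitudes along the finite word `w`. -/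
noncomputable def wordMap (lam : ℝ) (N : ℕ) (w : Fin N → Fin m) (y : EuclideanSpace ℝ (Fin d)) :
    EuclideanSpace ℝ (Fin d) :=
  (lam⁻¹ - 1) • ∑ n : Fin N, lam ^ (n.val + 1) • p (w n) + lam ^ N • y

theorem addressPoint_eq_wordMap (h0 : 0 < lam) (h1 : lam < 1) (N : ℕ) (i : ℕ → Fin m) :
    addressPoint p lam i =
      wordMap p lam N (fun n => i n) (addressPoint p lam fun n => i (n + N)) := by
  have htail : ∑' n : ℕ, lam ^ (n + N + 1) • p (i (n + N)) =
      lam ^ N • ∑' n : ℕ, lam ^ (n + 1) • p (i (n + N)) := by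
    rw [← tsum_const_smul'']
    refine tsum_congr fun n => ?_
    rw [smul_smul, ← pow_add]
    congr 2
    ring
  simp only [addressPoint, wordMap]
  rw [← (summable_address p h0 h1 i).sum_add_tsum_nat_add N, htail, smul_add,
    smul_comm (lam ^ N), Finset.sum_range]

theorem dimH_image_wordMap_le (N : ℕ) (w : Fin N → Fin m) (s : Set (EuclideanSpace ℝ (Fin d))) :
    dimH (wordMap p lam N w '' s) ≤ dimH s := by
  have h : LipschitzWith ‖lam ^ N‖₊ (wordMap p lam N w) :=
    LipschitzWith.of_dist_le_mul fun x y => by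
      simp [wordMap, dist_smul₀]
  exact h.dimH_image_le s

end

/-- A nonempty closed set of sequences with fewer than continuum many elements has an element
determined in the set by a finite prefix. -/
theorem exists_prefix_isolated_of_mk_lt_continuum {m : ℕ} {C : Set (ℕ → Fin m)}
    (hC : IsClosed C) (hne : C.Nonempty) (hcard : Cardinal.mk C < Cardinal.continuum) :
    ∃ i ∈ C, ∃ N : ℕ, ∀ j ∈ C, (∀ n < N, j n = i n) → j = i := by
  by_contra! H
  have hperf : Perfect C := by
    refine ⟨hC, preperfect_iff_nhds.2 fun i hi U hU => ?_⟩
    obtain ⟨V, hVU, hV, hiV⟩ := mem_nhds_iff.1 hU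
    obtain ⟨I, u, hu, hIV⟩ := isOpen_pi_iff.1 hV i hiV
    obtain ⟨j, hj, hji, hne⟩ := H i hi (I.sup id + 1)
    refine ⟨j, ⟨hVU (hIV fun n hn => ?_), hj⟩, hne⟩
    rw [hji n (Nat.lt_succ_of_le (Finset.le_sup (f := id) hn))]
    exact (hu n hn).2
  let := TopologicalSpace.upgradeIsCompletelyMetrizable (ℕ → Fin m)
  obtain ⟨f, hf, -, hinj⟩ := hperf.exists_nat_bool_injection hne
  refine hcard.not_ge ?_
  have := Cardinal.mk_le_of_injective
    (f := fun b => (⟨f b, hf ⟨b, rfl⟩⟩ : C)) fun a b h => hinj (congrArg Subtype.val h)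
  simpa using this


/-- The set `V_λ` of points of the attractor having fewer than a continuum of
addresses and the set of uniqueness `U_λ` (points with exactly one address)
have the same Hausdorff dimension. -/
theorem stmt7 (d m : ℕ) (hd : 1 ≤ d) (hm : 2 ≤ m)
    (p : Fin m → EuclideanSpace ℝ (Fin d)) (hp : Function.Injective p)
    (lam : ℝ) (h0 : 0 < lam) (h1 : lam < 1) :
    dimH {x : EuclideanSpace ℝ (Fin d) |
        (∃ i : ℕ → Fin m, x = (lam⁻¹ - 1) • ∑' n : ℕ, lam ^ (n + 1) • p (i n)) ∧
        Cardinal.mk {i : ℕ → Fin m //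
          x = (lam⁻¹ - 1) • ∑' n : ℕ, lam ^ (n + 1) • p (i n)} < Cardinal.continuum} =
    dimH {x : EuclideanSpace ℝ (Fin d) |
        ∃! i : ℕ → Fin m, x = (lam⁻¹ - 1) • ∑' n : ℕ, lam ^ (n + 1) • p (i n)} := by
  refine le_antisymm ?_ (dimH_mono ?_)
  · set U := {x : EuclideanSpace ℝ (Fin d) |
        ∃! i : ℕ → Fin m, x = (lam⁻¹ - 1) • ∑' n : ℕ, lam ^ (n + 1) • p (i n)} with hU
    refine (dimH_mono (t := ⋃ w : Σ N : ℕ, Fin N → Fin m, wordMap p lam w.1 w.2 '' U) ?_).trans ?_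
    · rintro x ⟨⟨i₀, hi₀⟩, hcard⟩
      have hC : IsClosed {i | x = addressPoint p lam i} :=
        isClosed_eq continuous_const (continuous_addressPoint p h0 h1)
      obtain ⟨i, hi, N, hN⟩ := exists_prefix_isolated_of_mk_lt_continuum hC ⟨i₀, hi₀⟩ hcard
      refine Set.mem_iUnion.2 ⟨⟨N, fun n => i n⟩, addressPoint p lam fun n => i (n + N),
        ⟨fun n => i (n + N), rfl, fun k hk => ?_⟩,
        (addressPoint_eq_wordMap p h0 h1 N i).symm.trans hi.symm⟩
      change addressPoint p lam _ = addressPoint p lam k at hk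
      have hj := hN (fun n => if n < N then i n else k (n - N)) ?_ fun n hn => if_pos hn
      · funext n
        simpa using congrFun hj (n + N)
      · change x = addressPoint p lam _
        rw [addressPoint_eq_wordMap p h0 h1 N]
        simpa [← hk, ← addressPoint_eq_wordMap p h0 h1 N i] using hi
    · rw [dimH_iUnion]
      exact iSup_le fun w => dimH_image_wordMap_le p w.1 w.2 U
  · rintro x ⟨i, hi, huniq⟩
    refine ⟨⟨i, hi⟩, lt_of_le_of_lt (Cardinal.le_one_iff_subsingleton.2 ⟨fun a b => ?_⟩)
      (Cardinal.one_lt_aleph0.trans Cardinal.aleph0_lt_continuum)⟩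
    exact Subtype.ext ((huniq _ a.2).trans (huniq _ b.2).symm)
end

section
/- Let d ≥ 1 and A ⊆ ℝ^d. Suppose there exists δ > 0 such that for every (axis-parallel, closed, nondegenerate) cube C ⊆ ℝ^d that intersects A, there is a cube C_0 ⊆ C with Lebesgue measure L_d(C_0) ≥ δ·L_d(C) and C_0 ∩ A = ∅. Then the Hausdorff dimension of A is strictly less than d. -/
open MeasureTheory

/-- Axis-parallel closed cube with lower corner `x` and side length `ε`. -/
def cube {d : ℕ} (x : EuclideanSpace ℝ (Fin d)) (ε : ℝ) : Set (EuclideanSpace ℝ (Fin d)) :=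
  {y | ∀ i, y i ∈ Set.Icc (x i) (x i + ε)}

open scoped ENNReal NNReal

theorem volume_cube {d : ℕ} (x : EuclideanSpace ℝ (Fin d)) (ε : ℝ) :
    volume (cube x ε) = ENNReal.ofReal ε ^ d := by
  have h : cube x ε = WithLp.ofLp ⁻¹' Set.pi Set.univ fun i => Set.Icc (x i) (x i + ε) := by
    ext y
    simp only [cube, Set.mem_ofPred_eq, Set.mem_preimage, Set.mem_univ_pi]
  rw [h, (PiLp.volume_preserving_ofLp (Fin d)).measure_preimage
    (MeasurableSet.univ_pi fun _ => measurableSet_Icc).nullMeasurableSet, volume_pi_pi]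
  simp

theorem ediam_cube_le {d : ℕ} (x : EuclideanSpace ℝ (Fin d)) {ε : ℝ} (hε : 0 ≤ ε) :
    Metric.ediam (cube x ε) ≤ ENNReal.ofReal (d * ε) := by
  refine Metric.ediam_le fun y hy z hz => ?_
  rw [edist_dist]
  refine ENNReal.ofReal_le_ofReal ?_
  rw [EuclideanSpace.dist_eq, Real.sqrt_le_iff]
  refine ⟨by positivity, ?_⟩
  calc ∑ i, dist (y i) (z i) ^ 2 ≤ ∑ _i : Fin d, ε ^ 2 := by
        refine Finset.sum_le_sum fun i _ => ?_
        have h := Real.dist_le_of_mem_Icc (hy i) (hz i)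
        rw [add_sub_cancel_left] at h
        gcongr
    _ = d * ε ^ 2 := by simp
    _ ≤ (d * ε) ^ 2 := by
        rw [mul_pow]
        gcongr
        exact_mod_cast Nat.le_self_pow two_ne_zero d

/-- The bounds on the corners of a nondegenerate cube contained in another cube. -/
theorem cube_subset_cube {d : ℕ} {x y : EuclideanSpace ℝ (Fin d)} {ε η : ℝ} (hη : 0 ≤ η)
    (h : cube y η ⊆ cube x ε) (i : Fin d) : x i ≤ y i ∧ y i + η ≤ x i + ε := by
  have h₁ : y ∈ cube x ε := h fun i => ⟨le_rfl, by linarith⟩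
  have h₂ : WithLp.toLp 2 (fun i => y i + η) ∈ cube x ε :=
    h fun i => ⟨by simpa using hη, by simp⟩
  exact ⟨(h₁ i).1, (h₂ i).2⟩

/-- Every point of a cube lies in one of the `N ^ d` mesh cubes of side `ε / N`. -/
theorem exists_mem_mesh_cube {d N : ℕ} (hN : 0 < N) {x y : EuclideanSpace ℝ (Fin d)} {ε : ℝ}
    (hε : 0 < ε) (hy : y ∈ cube x ε) :
    ∃ k : Fin d → Fin N, y ∈ cube (WithLp.toLp 2 fun i => x i + (k i : ℕ) * (ε / N)) (ε / N) := by
  have hNr : (0 : ℝ) < N := by exact_mod_cast hN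
  set r := ε / N with hr
  have hr0 : 0 < r := by positivity
  have hNε : N * r = ε := by rw [hr]; field_simp
  suffices h : ∀ i, ∃ k : Fin N, y i ∈ Set.Icc (x i + (k : ℕ) * r) (x i + (k : ℕ) * r + r) by
    choose k hk using h
    exact ⟨k, hk⟩
  intro i
  obtain ⟨h₁, h₂⟩ := hy i
  by_cases hlt : ⌊(y i - x i) / r⌋₊ < N
  · refine ⟨⟨_, hlt⟩, ?_, ?_⟩
    · have := Nat.floor_le (a := (y i - x i) / r) (div_nonneg (by linarith) hr0.le)
      rw [le_div_iff₀ hr0] at this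
      dsimp only
      linarith
    · have := (Nat.lt_floor_add_one ((y i - x i) / r)).le
      rw [div_le_iff₀ hr0] at this
      dsimp only
      linarith
  · have hle : (N : ℝ) ≤ (y i - x i) / r :=
      (Nat.le_floor_iff (div_nonneg (by linarith) hr0.le)).1 (not_lt.1 hlt)
    rw [le_div_iff₀ hr0] at hle
    refine ⟨⟨N - 1, by omega⟩, ?_, ?_⟩ <;>
    · push_cast [Nat.cast_sub (show 1 ≤ N from hN)]
      linarith

/-- A subcube whose side is at least twice the mesh size contains a mesh cube. -/
theorem exists_mesh_cube_subset {d N : ℕ} (hN : 0 < N) {x y : EuclideanSpace ℝ (Fin d)} {ε η : ℝ}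
    (hε : 0 < ε) (hη : 2 * (ε / N) ≤ η) (h : cube y η ⊆ cube x ε) :
    ∃ k : Fin d → Fin N,
      cube (WithLp.toLp 2 fun i => x i + (k i : ℕ) * (ε / N)) (ε / N) ⊆ cube y η := by
  have hNr : (0 : ℝ) < N := by exact_mod_cast hN
  set r := ε / N with hr
  have hr0 : 0 < r := by positivity
  have hNε : N * r = ε := by rw [hr]; field_simp
  suffices h : ∀ i, ∃ k : Fin N, y i ≤ x i + (k : ℕ) * r ∧ x i + (k : ℕ) * r + r ≤ y i + η by
    choose k hk using h
    exact ⟨k, fun z hz i => ⟨(hk i).1.trans (hz i).1, (hz i).2.trans (hk i).2⟩⟩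
  intro i
  obtain ⟨h₁, h₂⟩ := cube_subset_cube (by linarith) h i
  have hle := Nat.le_ceil ((y i - x i) / r)
  have hlt := Nat.ceil_lt_add_one (a := (y i - x i) / r) (div_nonneg (by linarith) hr0.le)
  rw [div_le_iff₀ hr0] at hle
  rw [← sub_lt_iff_lt_add, lt_div_iff₀ hr0, sub_mul, one_mul] at hlt
  refine ⟨⟨⌈(y i - x i) / r⌉₊, ?_⟩, by dsimp only; linarith, by dsimp only; linarith⟩
  have : (⌈(y i - x i) / r⌉₊ : ℝ) < N := by
    refine lt_of_mul_lt_mul_right ?_ hr0.le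
    linarith
  exact_mod_cast this

/-- If a cube meeting `A` contains a large enough subcube missing `A`, then the part of `A` in it
is covered by all but one of the mesh cubes. -/
theorem exists_finset_cover_cube {d N : ℕ} (hN : 0 < N) {A : Set (EuclideanSpace ℝ (Fin d))}
    {x y : EuclideanSpace ℝ (Fin d)} {ε η : ℝ} (hε : 0 < ε) (hη : 2 * (ε / N) ≤ η)
    (h : cube y η ⊆ cube x ε) (hA : cube y η ∩ A = ∅) :
    ∃ t : Finset (EuclideanSpace ℝ (Fin d)), t.card ≤ N ^ d - 1 ∧
      cube x ε ∩ A ⊆ ⋃ z ∈ t, cube z (ε / N) := by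
  classical
  obtain ⟨k₀, hk₀⟩ := exists_mesh_cube_subset hN hε hη h
  refine ⟨(Finset.univ.erase k₀).image fun k : Fin d → Fin N =>
    WithLp.toLp 2 fun i => x i + (k i : ℕ) * (ε / N), Finset.card_image_le.trans ?_, ?_⟩
  · simp [Finset.card_erase_of_mem]
  · rintro z ⟨hz, hzA⟩
    obtain ⟨k, hk⟩ := exists_mem_mesh_cube hN hε hz
    have hne : k ≠ k₀ := by
      rintro rfl
      exact Set.notMem_empty z (hA ▸ ⟨hk₀ hk, hzA⟩)
    exact Set.mem_iUnion₂.2 ⟨_, Finset.mem_image_of_mem _ (by simpa using hne), hk⟩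

/-- Iterating a one-step cover of the parts of `A` in cubes. -/
theorem exists_finset_cover_iterate {d N M : ℕ} (hN : 0 < N) {A : Set (EuclideanSpace ℝ (Fin d))}
    (H : ∀ (x : EuclideanSpace ℝ (Fin d)) (ε : ℝ), 0 < ε →
      ∃ t : Finset (EuclideanSpace ℝ (Fin d)), t.card ≤ M ∧
        cube x ε ∩ A ⊆ ⋃ z ∈ t, cube z (ε / N))
    (x : EuclideanSpace ℝ (Fin d)) {ε : ℝ} (hε : 0 < ε) (n : ℕ) :
    ∃ t : Finset (EuclideanSpace ℝ (Fin d)), t.card ≤ M ^ n ∧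
      cube x ε ∩ A ⊆ ⋃ z ∈ t, cube z (ε / N ^ n) := by
  classical
  induction n with
  | zero => exact ⟨{x}, by simp, by simp⟩
  | succ n ih =>
    obtain ⟨t, ht, hcov⟩ := ih
    choose S hS hScov using fun z => H z (ε / N ^ n) (by positivity)
    refine ⟨t.biUnion S, ?_, ?_⟩
    · calc (t.biUnion S).card ≤ t.card * M := Finset.card_biUnion_le_card_mul _ _ _ fun z _ => hS z
        _ ≤ M ^ n * M := by gcongr
        _ = M ^ (n + 1) := (pow_succ _ _).symm
    · intro a ha
      obtain ⟨z, hz, haz⟩ := Set.mem_iUnion₂.1 (hcov ha)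
      obtain ⟨w, hw, haw⟩ := Set.mem_iUnion₂.1 (hScov z ⟨haz, ha.2⟩)
      refine Set.mem_iUnion₂.2 ⟨w, Finset.mem_biUnion.2 ⟨z, hz, hw⟩, ?_⟩
      rwa [pow_succ, ← div_div]

/-- A set covered by `M ^ n` cubes of side `ε / N ^ n` for every `n` has Hausdorff dimension at most
`s`, where `N ^ s = M`. -/
theorem dimH_le_of_finset_cover {d N M : ℕ} (hN : 1 < N) {s : ℝ≥0} (hs : (N : ℝ) ^ (s : ℝ) = M)
    {B : Set (EuclideanSpace ℝ (Fin d))} {ε : ℝ} (hε : 0 < ε)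
    (H : ∀ n : ℕ, ∃ t : Finset (EuclideanSpace ℝ (Fin d)), t.card ≤ M ^ n ∧
      B ⊆ ⋃ z ∈ t, cube z (ε / N ^ n)) :
    dimH B ≤ s := by
  borelize (EuclideanSpace ℝ (Fin d))
  have hNr : (1 : ℝ) < N := by exact_mod_cast hN
  choose t ht hcov using H
  have hM : 0 < (M : ℝ) := hs ▸ by positivity
  refine dimH_le_of_hausdorffMeasure_ne_top (ne_top_of_le_ne_top
    (b := ENNReal.ofReal ((d * ε) ^ (s : ℝ))) ENNReal.ofReal_ne_top ?_)
  have hlim : Filter.Tendsto (fun n : ℕ => ENNReal.ofReal (d * (ε / N ^ n)))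
      Filter.atTop (nhds 0) := by
    rw [← ENNReal.ofReal_zero]
    refine ENNReal.tendsto_ofReal ?_
    have h := tendsto_pow_atTop_nhds_zero_of_lt_one (r := ((N : ℝ))⁻¹) (by positivity)
      (inv_lt_one_of_one_lt₀ hNr)
    simpa [div_eq_mul_inv, mul_assoc] using h.const_mul (d * ε : ℝ)
  refine (Measure.hausdorffMeasure_le_liminf_sum (ι := fun n => t n) s B _ hlim
    (fun n z => cube z.1 (ε / N ^ n)) (.of_forall fun n z => ediam_cube_le _ (by positivity))
    (.of_forall fun n => ?_)).trans ?_
  · simpa [Set.iUnion_subtype] using hcov n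
  refine Filter.liminf_le_of_le (by isBoundedDefault) fun b hb => ?_
  obtain ⟨n, hn⟩ := hb.exists
  refine hn.trans ?_
  calc ∑ z : t n, Metric.ediam (cube z.1 (ε / N ^ n)) ^ (s : ℝ)
      ≤ ∑ _z : t n, ENNReal.ofReal ((d * (ε / N ^ n)) ^ (s : ℝ)) := by
        refine Finset.sum_le_sum fun z _ => ?_
        rw [← ENNReal.ofReal_rpow_of_nonneg (by positivity) s.coe_nonneg]
        gcongr
        exact ediam_cube_le _ (by positivity)
    _ = ENNReal.ofReal ((t n).card * (d * (ε / N ^ n)) ^ (s : ℝ)) := by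
        rw [ENNReal.ofReal_mul (by positivity)]
        simp
    _ ≤ ENNReal.ofReal ((d * ε) ^ (s : ℝ)) := by
        refine ENNReal.ofReal_le_ofReal ?_
        rw [← mul_div_assoc, Real.div_rpow (by positivity) (by positivity),
          ← Real.rpow_pow_comm (by positivity), hs, mul_div_assoc', div_le_iff₀ (by positivity),
          mul_comm]
        gcongr
        exact_mod_cast ht n

theorem exists_mem_cube {d : ℕ} (y : EuclideanSpace ℝ (Fin d)) :
    ∃ n : ℕ, y ∈ cube (WithLp.toLp 2 fun _ => -((n : ℝ) + 1)) (2 * (n + 1)) := by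
  obtain ⟨n, hn⟩ := exists_nat_ge ‖y‖
  refine ⟨n, fun i => ?_⟩
  have := abs_le.1 ((PiLp.norm_apply_le y i).trans hn)
  exact ⟨by simp only; linarith [this.1], by simp only; linarith [this.2]⟩

/-- If there is `δ > 0` such that every cube `C` meeting `A` contains a subcube
`C₀` of volume at least `δ·L_d(C)` disjoint from `A`, then `dim_H A < d`. -/
theorem stmt9 (d : ℕ) (hd : 1 ≤ d) (A : Set (EuclideanSpace ℝ (Fin d)))
    (hA : ∃ δ : ℝ, 0 < δ ∧
      ∀ (x : EuclideanSpace ℝ (Fin d)) (ε : ℝ), 0 < ε → (cube x ε ∩ A).Nonempty →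
        ∃ (x0 : EuclideanSpace ℝ (Fin d)) (ε0 : ℝ), 0 < ε0 ∧
          cube x0 ε0 ⊆ cube x ε ∧
          ENNReal.ofReal δ * volume (cube x ε) ≤ volume (cube x0 ε0) ∧
          cube x0 ε0 ∩ A = ∅) :
    dimH A < d := by
  obtain ⟨δ, hδ, hA⟩ := hA
  obtain ⟨N, hN, hNδ⟩ : ∃ N : ℕ, 2 ≤ N ∧ 2 / (N : ℝ) ≤ δ := by
    refine ⟨⌈2 / δ⌉₊ + 2, by omega, ?_⟩
    rw [div_le_comm₀ (by positivity) hδ]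
    push_cast
    linarith [Nat.le_ceil (2 / δ)]
  have hNr : (2 : ℝ) ≤ N := by exact_mod_cast hN
  have hcover : ∀ (x : EuclideanSpace ℝ (Fin d)) (ε : ℝ), 0 < ε →
      ∃ t : Finset (EuclideanSpace ℝ (Fin d)), t.card ≤ N ^ d - 1 ∧
        cube x ε ∩ A ⊆ ⋃ z ∈ t, cube z (ε / N) := by
    intro x ε hε
    obtain hempty | hne := (cube x ε ∩ A).eq_empty_or_nonempty
    · exact ⟨∅, by simp, by simp [hempty]⟩
    obtain ⟨y, η, hη, hsub, hvol, hdisj⟩ := hA x ε hε hne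
    refine exists_finset_cover_cube (by omega) hε ?_ hsub hdisj
    rw [volume_cube, volume_cube, ← ENNReal.ofReal_pow hε.le, ← ENNReal.ofReal_pow hη.le,
      ← ENNReal.ofReal_mul hδ.le, ENNReal.ofReal_le_ofReal_iff (by positivity)] at hvol
    refine le_of_pow_le_pow_left₀ (by omega) hη.le (le_trans ?_ hvol)
    rw [mul_div_left_comm, mul_comm, mul_pow]
    gcongr
    exact (pow_le_of_le_one (by positivity) (div_le_one_of_le₀ hNr (by positivity))
      (by omega)).trans hNδ
  have hM : 1 ≤ N ^ d - 1 := by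
    have := Nat.pow_le_pow_right (n := N) (by omega) hd
    rw [pow_one] at this
    omega
  set M := N ^ d - 1 with hMdef
  have hMr : (1 : ℝ) ≤ M := by exact_mod_cast hM
  let s : ℝ≥0 := ⟨Real.logb N M, Real.logb_nonneg (by linarith) hMr⟩
  have hs : (N : ℝ) ^ (s : ℝ) = M := Real.rpow_logb (by linarith) (by linarith) (by linarith)
  have hsd : (s : ℝ≥0∞) < d := by
    have h : (s : ℝ) < d := by
      refine (Real.logb_lt_iff_lt_rpow (by linarith) (by linarith)).2 ?_
      rw [Real.rpow_natCast]
      exact_mod_cast (show M < N ^ d by omega)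
    exact_mod_cast h
  refine lt_of_le_of_lt ?_ hsd
  calc dimH A ≤ dimH (⋃ n : ℕ,
        cube (WithLp.toLp 2 fun _ => -((n : ℝ) + 1)) (2 * (n + 1)) ∩ A) := by
        refine dimH_mono fun y hy => ?_
        obtain ⟨n, hn⟩ := exists_mem_cube y
        exact Set.mem_iUnion.2 ⟨n, hn, hy⟩
    _ ≤ s := by
        rw [dimH_iUnion]
        refine iSup_le fun n => ?_
        have hε : (0 : ℝ) < 2 * (n + 1) := by positivity
        exact dimH_le_of_finset_cover (by omega) hs hε
          (exists_finset_cover_iterate (by omega) hcover _ hε)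
end

section
/- Let d ≥ 1, m ≥ 2, distinct points p_0,…,p_{m−1} ∈ ℝ^d whose convex hull Ω has nonempty interior, λ ∈ (0,1), and f_j(x) = λx + (1−λ)p_j. Assume: (a) Ω = ⋃_{j=0}^{m−1} f_j(Ω) (no holes); (b) there exist indices i ≠ k in {0,…,m−1} and an extreme point p_j of Ω such that f_k(p_j) lies in the interior of f_i(Ω) (i.e., a vertex of f_k(Ω) belongs to the interior of f_i(Ω)). Then the exceptional set V_λ = { x ∈ Ω : the set of addresses of x has cardinality < 2^ℵ₀ } has Hausdorff dimension strictly less than d; in particular, Lebesgue-almost every x ∈ Ω has 2^ℵ₀ distinct addresses. -/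
open MeasureTheory

open Set Filter Metric Topology

section Porous

/-- `E` is uniformly porous with constant `c`: every closed ball of radius `s ≤ 1` contains the
centre of a ball of radius `c * s` that misses `E`. -/
def IsUniformlyPorous {X : Type*} [PseudoMetricSpace X] (c : ℝ) (E : Set X) : Prop :=
  ∀ z : X, ∀ s ∈ Ioc (0 : ℝ) 1, ∃ y ∈ closedBall z s, Disjoint (closedBall y (c * s)) E

lemma exists_abs_sub_grid_le {M : ℕ} (hM : 0 < M) {s u : ℝ} (hs : 0 < s) (hu : |u| ≤ s) :
    ∃ q : Fin M, |u - s * (-1 + (2 * (q : ℝ) + 1) / M)| ≤ s / M := by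
  have hM' : (0 : ℝ) < M := by exact_mod_cast hM
  obtain ⟨hu1, hu2⟩ := abs_le.1 hu
  set v : ℝ := (u + s) * M / (2 * s) with hv
  have hv0 : 0 ≤ v := by
    have : 0 ≤ u + s := by linarith
    positivity
  have hvM : v ≤ M := by
    rw [hv, div_le_iff₀ (by positivity)]
    nlinarith
  have huv : u = s * (-1 + 2 * v / M) := by
    rw [hv]; field_simp; ring
  suffices ∃ q : Fin M, |2 * v - (2 * (q : ℝ) + 1)| ≤ 1 by
    obtain ⟨q, hq⟩ := this
    refine ⟨q, ?_⟩
    have : u - s * (-1 + (2 * (q : ℝ) + 1) / M) = s / M * (2 * v - (2 * (q : ℝ) + 1)) := by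
      rw [huv]; field_simp; ring
    rw [this, abs_mul, abs_of_pos (div_pos hs hM')]
    exact mul_le_of_le_one_right (by positivity) hq
  rcases lt_or_ge v M with h | h
  · refine ⟨⟨⌊v⌋₊, (Nat.floor_lt hv0).2 h⟩, ?_⟩
    have h1 := Nat.floor_le hv0
    have h2 := Nat.lt_floor_add_one v
    rw [abs_le]
    constructor <;> simp only <;> linarith
  · have hvM : v = M := le_antisymm hvM h
    refine ⟨⟨M - 1, by omega⟩, ?_⟩
    have : ((M - 1 : ℕ) : ℝ) = M - 1 := by
      rw [Nat.cast_sub hM]; simp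
    simp only [this, hvM]
    rw [abs_le]
    constructor <;> linarith

variable {ι : Type*} [Fintype ι]

lemma exists_mem_closedBall_grid {M : ℕ} (hM : 0 < M) {s : ℝ} (hs : 0 < s) {x z : ι → ℝ}
    (hx : x ∈ closedBall z s) :
    ∃ q : ι → Fin M,
      x ∈ closedBall (z + s • fun i => -1 + (2 * ((q i : ℕ) : ℝ) + 1) / M) (s / M) := by
  rw [mem_closedBall, dist_pi_le_iff hs.le] at hx
  choose q hq using fun i => exists_abs_sub_grid_le hM hs (u := x i - z i)
    (by simpa [Real.dist_eq] using hx i)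
  refine ⟨q, ?_⟩
  rw [mem_closedBall, dist_pi_le_iff (by positivity)]
  intro i
  have := hq i
  rw [Real.dist_eq]
  simpa [sub_sub] using this

lemma exists_finset_cover_of_isUniformlyPorous {c : ℝ} {E : Set (ι → ℝ)} {M : ℕ} (hM : 0 < M)
    (hcM : 2 ≤ c * M) (h : IsUniformlyPorous c E) (z₀ : ι → ℝ) (n : ℕ) :
    ∃ T : Finset (ι → ℝ), T.card ≤ (M ^ Fintype.card ι - 1) ^ n ∧
      E ∩ closedBall z₀ 1 ⊆ ⋃ z ∈ T, closedBall z ((M : ℝ)⁻¹ ^ n) := by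
  classical
  have hM' : (0 : ℝ) < M := by exact_mod_cast hM
  set g : (ι → ℝ) → ℝ → (ι → Fin M) → ι → ℝ :=
    fun z s q => z + s • fun i => -1 + (2 * ((q i : ℕ) : ℝ) + 1) / M with hg
  have key : ∀ z : ι → ℝ, ∀ s ∈ Ioc (0 : ℝ) 1, ∃ q,
      Disjoint (closedBall (g z s q) (s / M)) E := by
    intro z s hs
    obtain ⟨y, hy, hyE⟩ := h z s hs
    obtain ⟨q, hq⟩ := exists_mem_closedBall_grid hM hs.1 hy
    refine ⟨q, hyE.mono_left fun x hx => ?_⟩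
    rw [mem_closedBall] at hx hq ⊢
    have : s / M + s / M ≤ c * s := by
      rw [← add_div, div_le_iff₀ hM']
      nlinarith [hs.1]
    rw [dist_comm] at hq
    linarith [dist_triangle x (g z s q) y]
  have : Nonempty (ι → Fin M) := ⟨fun _ => ⟨0, hM⟩⟩
  choose! bad hbad using key
  induction n with
  | zero => exact ⟨{z₀}, by simp, by simp⟩
  | succ n ih =>
    obtain ⟨T, hT, hcov⟩ := ih
    have hs : (M : ℝ)⁻¹ ^ n ∈ Ioc (0 : ℝ) 1 :=
      ⟨by positivity, pow_le_one₀ (by positivity) (inv_le_one_of_one_le₀ (by exact_mod_cast hM))⟩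
    set s : ℝ := (M : ℝ)⁻¹ ^ n with hs_def
    refine ⟨T.biUnion fun z => (Finset.univ.erase (bad z s)).image (g z s), ?_, ?_⟩
    · calc _ ≤ T.card * (M ^ Fintype.card ι - 1) := by
            refine Finset.card_biUnion_le_card_mul _ _ _ fun z _ => Finset.card_image_le.trans ?_
            rw [Finset.card_erase_of_mem (Finset.mem_univ _), Finset.card_univ]
            simp
        _ ≤ _ := by
            rw [pow_succ]
            exact Nat.mul_le_mul_right _ hT
    · intro x hx
      have := hcov hx
      simp only [mem_iUnion] at this
      obtain ⟨z, hzT, hxz⟩ := this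
      obtain ⟨q, hq⟩ := exists_mem_closedBall_grid hM hs.1 hxz
      have hqb : q ≠ bad z s := by
        rintro rfl
        exact (disjoint_left.1 (hbad z s hs)) hq hx.1
      simp only [mem_iUnion]
      refine ⟨g z s q, ?_, ?_⟩
      · rw [Finset.mem_biUnion]
        exact ⟨z, hzT, Finset.mem_image_of_mem _ (by simp [hqb])⟩
      · rw [pow_succ, ← div_eq_mul_inv]
        exact hq

lemma dimH_inter_closedBall_le_of_isUniformlyPorous [Nonempty ι] {c : ℝ} {E : Set (ι → ℝ)}
    {M : ℕ} (hM : 2 ≤ M) (hcM : 2 ≤ c * M) (h : IsUniformlyPorous c E) (z₀ : ι → ℝ) :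
    dimH (E ∩ closedBall z₀ 1) ≤ ENNReal.ofReal (Real.logb M (M ^ Fintype.card ι - 1 : ℕ)) := by
  have hM1 : (1 : ℝ) < M := by exact_mod_cast hM
  have hM0 : (0 : ℝ) < M := by linarith
  set K : ℕ := M ^ Fintype.card ι - 1 with hK
  have hK1 : 1 ≤ K := by
    have : 2 ^ 1 ≤ M ^ Fintype.card ι :=
      (Nat.pow_le_pow_left hM 1).trans (Nat.pow_le_pow_right (by omega) Fintype.card_pos)
    omega
  set σ : ℝ := Real.logb M K with hσ
  have hσ0 : 0 ≤ σ := Real.logb_nonneg hM1 (by exact_mod_cast hK1)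
  have hMσ : (M : ℝ) ^ σ = K := Real.rpow_logb hM0 hM1.ne' (by exact_mod_cast hK1)
  choose T hTcard hTcov using
    exists_finset_cover_of_isUniformlyPorous (by omega : 0 < M) hcM h z₀
  refine dimH_le_of_hausdorffMeasure_ne_top (ne_top_of_le_ne_top (ENNReal.ofReal_ne_top
    (r := 2 ^ σ)) ?_)
  rw [Real.coe_toNNReal _ hσ0]
  have hdiam : ∀ n : ℕ, ∀ z : ι → ℝ,
      ediam (closedBall z ((M : ℝ)⁻¹ ^ n)) ≤ ENNReal.ofReal (2 * (M : ℝ)⁻¹ ^ n) := by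
    intro n z
    refine ediam_le_of_forall_dist_le fun x hx y hy => ?_
    rw [two_mul]
    exact (dist_triangle_right x y z).trans (add_le_add hx hy)
  have hr : Tendsto (fun n : ℕ => ENNReal.ofReal (2 * (M : ℝ)⁻¹ ^ n)) atTop (𝓝 0) := by
    rw [← ENNReal.ofReal_zero]
    refine ENNReal.tendsto_ofReal ?_
    simpa using (tendsto_pow_atTop_nhds_zero_of_lt_one (by positivity)
      (inv_lt_one_of_one_lt₀ hM1)).const_mul (2 : ℝ)
  refine (Measure.hausdorffMeasure_le_liminf_sum (ι := fun n => T n) σ _ _ hr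
    (fun n z => closedBall z.1 ((M : ℝ)⁻¹ ^ n)) (.of_forall fun n z => hdiam n z)
    (.of_forall fun n => ?_)).trans ?_
  · refine (hTcov n).trans fun x hx => ?_
    simpa using hx
  · refine liminf_le_of_le (by isBoundedDefault) fun b hb => ?_
    obtain ⟨n, hn⟩ := hb.exists
    refine hn.trans ?_
    calc _ ≤ ∑ _z : T n, ENNReal.ofReal (2 * (M : ℝ)⁻¹ ^ n) ^ σ :=
          Finset.sum_le_sum fun z _ => ENNReal.rpow_le_rpow (hdiam n z) hσ0
      _ = (T n).card * ENNReal.ofReal ((2 * (M : ℝ)⁻¹ ^ n) ^ σ) := by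
          rw [ENNReal.ofReal_rpow_of_nonneg (by positivity) hσ0]
          simp
      _ ≤ (K ^ n : ℕ) * ENNReal.ofReal ((2 * (M : ℝ)⁻¹ ^ n) ^ σ) := by
          gcongr
          exact_mod_cast hTcard n
      _ = ENNReal.ofReal (2 ^ σ) := by
          rw [← ENNReal.ofReal_natCast, ← ENNReal.ofReal_mul (by positivity)]
          congr 1
          have : ((M : ℝ)⁻¹ ^ n) ^ σ = ((K : ℝ) ^ n)⁻¹ := by
            rw [inv_pow, Real.inv_rpow (by positivity), ← Real.rpow_natCast_mul hM0.le,
              mul_comm, Real.rpow_mul_natCast hM0.le, hMσ]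
          rw [Real.mul_rpow (by norm_num) (by positivity), this]
          have : (K : ℝ) ≠ 0 := by positivity
          push_cast
          field_simp

/-- A uniformly porous subset of `ℝ^ι` has Hausdorff dimension less than the dimension of the
space. -/
lemma dimH_lt_card_of_isUniformlyPorous [Nonempty ι] {c : ℝ} (hc : 0 < c) {E : Set (ι → ℝ)}
    (h : IsUniformlyPorous c E) : dimH E < Fintype.card ι := by
  obtain ⟨M₀, hM₀⟩ := exists_nat_ge (2 / c)
  set M := max 2 M₀
  have hM : 2 ≤ M := le_max_left _ _
  have hcM : 2 ≤ c * M := by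
    rw [div_le_iff₀' hc] at hM₀
    exact hM₀.trans (by gcongr; exact le_max_right _ _)
  have hM1 : (1 : ℝ) < M := by exact_mod_cast hM
  have hle : dimH E ≤ ENNReal.ofReal (Real.logb M (M ^ Fintype.card ι - 1 : ℕ)) := by
    by_contra! hlt
    obtain ⟨x, -, hx⟩ := exists_mem_nhdsWithin_lt_dimH_of_lt_dimH hlt
    exact (hx _ (inter_mem self_mem_nhdsWithin (mem_nhdsWithin_of_mem_nhds
      (closedBall_mem_nhds x one_pos)))).not_ge
      (dimH_inter_closedBall_le_of_isUniformlyPorous hM hcM h x)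
  refine hle.trans_lt ?_
  rw [← ENNReal.ofReal_natCast, ENNReal.ofReal_lt_ofReal_iff (by exact_mod_cast Fintype.card_pos)]
  have hpow : 2 ≤ M ^ Fintype.card ι :=
    hM.trans (Nat.le_self_pow Fintype.card_ne_zero M)
  rw [Real.logb_lt_iff_lt_rpow hM1 (by exact_mod_cast (by omega : 0 < M ^ Fintype.card ι - 1)),
    Real.rpow_natCast]
  exact_mod_cast (by omega : M ^ Fintype.card ι - 1 < M ^ Fintype.card ι)

/-- Uniform porosity passes to the image under a continuous linear equivalence. -/
lemma IsUniformlyPorous.image_continuousLinearEquiv {V W : Type*} [NormedAddCommGroup V]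
    [NormedSpace ℝ V] [NormedAddCommGroup W] [NormedSpace ℝ W] (e : V ≃L[ℝ] W) {c : ℝ} (hc : 0 < c)
    {E : Set V} (h : IsUniformlyPorous c E) : ∃ c' > 0, IsUniformlyPorous c' (e '' E) := by
  set A : ℝ := max 1 ‖(e : V →L[ℝ] W)‖ with hA
  set B : ℝ := max 1 ‖(e.symm : W →L[ℝ] V)‖ with hB
  have hA1 : 1 ≤ A := le_max_left _ _
  have hB1 : 1 ≤ B := le_max_left _ _
  have hA0 : 0 < A := by linarith
  have hB0 : 0 < B := by linarith
  have hAe : ∀ v w, dist (e v) (e w) ≤ A * dist v w := fun v w => by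
    rw [dist_eq_norm, dist_eq_norm, ← map_sub]
    exact (e : V →L[ℝ] W).le_of_opNorm_le (le_max_right _ _) _
  have hBe : ∀ v w, dist (e.symm v) (e.symm w) ≤ B * dist v w := fun v w => by
    rw [dist_eq_norm, dist_eq_norm, ← map_sub]
    exact (e.symm : W →L[ℝ] V).le_of_opNorm_le (le_max_right _ _) _
  refine ⟨c / (A * B), by positivity, fun z s hs => ?_⟩
  obtain ⟨y, hy, hyE⟩ := h (e.symm z) (s / A)
    ⟨div_pos hs.1 hA0, (div_le_one₀ hA0).2 (hs.2.trans hA1)⟩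
  refine ⟨e y, ?_, disjoint_left.2 ?_⟩
  · rw [mem_closedBall] at hy ⊢
    have := hAe y (e.symm z)
    rw [e.apply_symm_apply] at this
    rw [le_div_iff₀' hA0] at hy
    exact this.trans hy
  · rintro _ hx ⟨x, hxE, rfl⟩
    refine disjoint_left.1 hyE ?_ hxE
    rw [mem_closedBall] at hx ⊢
    have := hBe (e x) (e y)
    rw [e.symm_apply_apply, e.symm_apply_apply] at this
    calc dist x y ≤ B * (c / (A * B) * s) := this.trans (by gcongr)
      _ = c * (s / A) := by field_simp

/-- A uniformly porous subset of a finite-dimensional real normed space has Hausdorff dimension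
less than the dimension of the space. -/
lemma IsUniformlyPorous.dimH_lt_finrank {V : Type*} [NormedAddCommGroup V] [NormedSpace ℝ V]
    [FiniteDimensional ℝ V] [Nontrivial V] {c : ℝ} (hc : 0 < c) {E : Set V}
    (h : IsUniformlyPorous c E) : dimH E < Module.finrank ℝ V := by
  have e : V ≃L[ℝ] (Fin (Module.finrank ℝ V) → ℝ) :=
    ContinuousLinearEquiv.ofFinrankEq (by simp)
  have : NeZero (Module.finrank ℝ V) := ⟨Module.finrank_pos.ne'⟩
  obtain ⟨c', hc', h'⟩ := h.image_continuousLinearEquiv e hc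
  simpa [e.dimH_image] using dimH_lt_card_of_isUniformlyPorous hc' h'

end Porous

section Coding

variable {m : ℕ} {V : Type*} [NormedAddCommGroup V] [NormedSpace ℝ V]

/-- The point with address `a` in the attractor of the maps `x ↦ lam • x + (1 - lam) • p j`. -/
noncomputable def codingMap (lam : ℝ) (p : Fin m → V) (a : ℕ → Fin m) : V :=
  (lam⁻¹ - 1) • ∑' n : ℕ, lam ^ (n + 1) • p (a n)

/-- The translation part of the composition of the maps along the first `N` letters of `a`. -/
noncomputable def codingPartialSum (lam : ℝ) (p : Fin m → V) (a : ℕ → Fin m) (N : ℕ) : V :=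
  (lam⁻¹ - 1) • ∑ n ∈ Finset.range N, lam ^ (n + 1) • p (a n)

/-- The points with exactly one address. -/
def uniqueAddressSet (lam : ℝ) (p : Fin m → V) : Set V :=
  {x | ∃! a, codingMap lam p a = x}

/-- The word `a 0, …, a (N - 1)` followed by the sequence `b`. -/
def prepend (a : ℕ → Fin m) (N : ℕ) (b : ℕ → Fin m) : ℕ → Fin m :=
  fun n => if n < N then a n else b (n - N)

lemma prepend_add (a b : ℕ → Fin m) (N n : ℕ) : prepend a N b (n + N) = b n := by
  simp [prepend]

lemma prepend_injective (a : ℕ → Fin m) (N : ℕ) : Function.Injective (prepend a N) := by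
  intro b c h
  funext n
  rw [← prepend_add a b N, h, prepend_add]

lemma codingPartialSum_congr (lam : ℝ) (p : Fin m → V) {a b : ℕ → Fin m} {N : ℕ}
    (h : ∀ n < N, a n = b n) : codingPartialSum lam p a N = codingPartialSum lam p b N := by
  unfold codingPartialSum
  congr 1
  exact Finset.sum_congr rfl fun n hn => by rw [h n (Finset.mem_range.1 hn)]

lemma countable_range_codingPartialSum (lam : ℝ) (p : Fin m → V) (N : ℕ) :
    (range fun a => codingPartialSum lam p a N).Countable := by
  refine (countable_range fun u : Fin N → Fin m =>
    (lam⁻¹ - 1) • ∑ n : Fin N, lam ^ ((n : ℕ) + 1) • p (u n)).mono ?_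
  rintro _ ⟨a, rfl⟩
  refine ⟨fun n => a n, ?_⟩
  simp only [codingPartialSum]
  rw [Fin.sum_univ_eq_sum_range (fun n => lam ^ (n + 1) • p (a n))]

variable {lam : ℝ}

lemma norm_coding_term_le (h0 : 0 < lam) (p : Fin m → V) (a : ℕ → Fin m) (n : ℕ) :
    ‖lam ^ (n + 1) • p (a n)‖ ≤ lam ^ (n + 1) * ∑ j, ‖p j‖ := by
  rw [norm_smul, Real.norm_of_nonneg (by positivity)]
  gcongr
  exact Finset.single_le_sum (f := fun j => ‖p j‖) (fun _ _ => norm_nonneg _)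
    (Finset.mem_univ (a n))

omit [NormedSpace ℝ V] in
lemma summable_coding_bound (h0 : 0 < lam) (h1 : lam < 1) (p : Fin m → V) :
    Summable fun n : ℕ => lam ^ (n + 1) * ∑ j, ‖p j‖ :=
  ((summable_nat_add_iff 1).2 (summable_geometric_of_lt_one h0.le h1)).mul_right _

lemma exists_norm_codingMap_le (h0 : 0 < lam) (h1 : lam < 1) (p : Fin m → V) :
    ∃ C, ∀ a, ‖codingMap lam p a‖ ≤ C := by
  refine ⟨‖lam⁻¹ - 1‖ * ∑' n : ℕ, lam ^ (n + 1) * ∑ j, ‖p j‖, fun a => ?_⟩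
  rw [codingMap, norm_smul]
  gcongr
  exact tsum_of_norm_bounded (summable_coding_bound h0 h1 p).hasSum (norm_coding_term_le h0 p a)

variable [CompleteSpace V]

lemma summable_coding (h0 : 0 < lam) (h1 : lam < 1) (p : Fin m → V) (a : ℕ → Fin m) :
    Summable fun n : ℕ => lam ^ (n + 1) • p (a n) :=
  (summable_coding_bound h0 h1 p).of_norm_bounded (norm_coding_term_le h0 p a)

lemma continuous_codingMap (h0 : 0 < lam) (h1 : lam < 1) (p : Fin m → V) :
    Continuous (codingMap lam p) := by
  refine (continuous_tsum (fun n => ?_) (summable_coding_bound h0 h1 p)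
    fun n a => norm_coding_term_le h0 p a n).const_smul _
  exact (continuous_of_discreteTopology (f := p)).comp (continuous_apply n) |>.const_smul _

lemma codingMap_eq_add (h0 : 0 < lam) (h1 : lam < 1) (p : Fin m → V) (a : ℕ → Fin m) (N : ℕ) :
    codingMap lam p a =
      codingPartialSum lam p a N + lam ^ N • codingMap lam p fun n => a (n + N) := by
  simp only [codingMap, codingPartialSum]
  rw [← (summable_coding h0 h1 p a).sum_add_tsum_nat_add N, smul_add, smul_comm (lam ^ N),
    ← (summable_coding h0 h1 p fun n => a (n + N)).tsum_const_smul (lam ^ N)]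
  congr 3
  funext n
  rw [smul_smul, ← pow_add, show N + (n + 1) = n + N + 1 by ring]

lemma codingMap_prepend (h0 : 0 < lam) (h1 : lam < 1) (p : Fin m → V) (a b : ℕ → Fin m) (N : ℕ) :
    codingMap lam p (prepend a N b) =
      codingPartialSum lam p a N + lam ^ N • codingMap lam p b := by
  rw [codingMap_eq_add h0 h1 p _ N,
    codingPartialSum_congr lam p (b := a) fun n hn => by simp [prepend, hn]]
  simp only [prepend_add]

/-- A sequence of points `y n` of a bounded set with `y n = f_{a n} (y (n + 1))` determines an
address of its first point. -/
lemma codingMap_eq_of_forall_eq (h0 : 0 < lam) (h1 : lam < 1) (p : Fin m → V) (a : ℕ → Fin m)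
    {y : ℕ → V} {C : ℝ} (hC : ∀ n, ‖y n‖ ≤ C)
    (hy : ∀ n, y n = lam • y (n + 1) + (1 - lam) • p (a n)) : codingMap lam p a = y 0 := by
  have hpart : ∀ N, y 0 = codingPartialSum lam p a N + lam ^ N • y N := by
    intro N
    induction N with
    | zero => simp [codingPartialSum]
    | succ N ih =>
      rw [ih, hy N]
      simp only [codingPartialSum, Finset.sum_range_succ, smul_add, smul_smul, ← pow_succ]
      have : lam ^ N * (1 - lam) = (lam⁻¹ - 1) * lam ^ (N + 1) := by
        rw [pow_succ]
        field_simp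
      rw [this]
      abel
  have hlim : Tendsto (fun N => lam ^ N) atTop (𝓝 0) :=
    tendsto_pow_atTop_nhds_zero_of_lt_one h0.le h1
  have h2 : Tendsto (fun N => lam ^ N • y N) atTop (𝓝 0) := by
    refine squeeze_zero_norm (a := fun N => lam ^ N * C) (fun N => ?_)
      (by simpa using hlim.mul_const C)
    rw [norm_smul, Real.norm_of_nonneg (by positivity)]
    gcongr
    exact hC N
  have h3 : Tendsto (codingPartialSum lam p a) atTop (𝓝 (codingMap lam p a)) :=
    (summable_coding h0 h1 p a).hasSum.tendsto_sum_nat.const_smul _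
  have h4 := h3.add h2
  simp only [← hpart, add_zero] at h4
  exact tendsto_nhds_unique h4 tendsto_const_nhds

/-- Every point of a bounded set covered by its images under the maps has an address. -/
lemma exists_codingMap_eq (h0 : 0 < lam) (h1 : lam < 1) (p : Fin m → V) {S : Set V}
    (hS : Bornology.IsBounded S)
    (hcov : ∀ x ∈ S, ∃ j, ∃ y ∈ S, x = lam • y + (1 - lam) • p j) {x : V} (hx : x ∈ S) :
    ∃ a, codingMap lam p a = x := by
  obtain ⟨C, hC⟩ := hS.exists_norm_le
  have : Nonempty (Fin m) := (hcov x hx).nonempty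
  choose! l g hg hlg using hcov
  have hmem : ∀ n, g^[n] x ∈ S := fun n => by
    induction n with
    | zero => exact hx
    | succ n ih =>
      rw [Function.iterate_succ_apply']
      exact hg _ ih
  refine ⟨fun n => l (g^[n] x), codingMap_eq_of_forall_eq h0 h1 p _ (y := fun n => g^[n] x)
    (fun n => hC _ (hmem n)) fun n => ?_⟩
  simp only [Function.iterate_succ_apply']
  exact hlg _ (hmem n)

/-- If some ball consists of points having two addresses, then the points with exactly one address
form a uniformly porous set. -/
lemma exists_isUniformlyPorous_uniqueAddressSet (h0 : 0 < lam) (h1 : lam < 1) (p : Fin m → V)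
    {o : V} {ρ : ℝ} (hρ : 0 < ρ)
    (ho : ∀ y ∈ closedBall o ρ, ∃ b c, b ≠ c ∧ codingMap lam p b = y ∧ codingMap lam p c = y) :
    ∃ c > 0, IsUniformlyPorous c (uniqueAddressSet lam p) := by
  obtain ⟨C, hC⟩ := exists_norm_codingMap_le h0 h1 p
  set D : ℝ := max 1 (‖o‖ + C) with hD
  have hD1 : 1 ≤ D := le_max_left _ _
  have hD0 : 0 < D := by linarith
  refine ⟨min (1 / 2) (lam / (2 * D) * ρ), by positivity, fun z s hs => ?_⟩
  by_cases hz : Disjoint (closedBall z (s / 2)) (uniqueAddressSet lam p)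
  · refine ⟨z, mem_closedBall_self hs.1.le, hz.mono_left (closedBall_subset_closedBall ?_)⟩
    nlinarith [min_le_left (1 / 2) (lam / (2 * D) * ρ), hs.1]
  · obtain ⟨x, hxz, a, hax, -⟩ := not_disjoint_iff.1 hz
    obtain ⟨n, hn1, hn2⟩ := exists_nat_pow_near_of_lt_one (x := s / (2 * D))
      (div_pos hs.1 (by positivity)) ((div_le_one₀ (by positivity)).2 (by linarith [hs.2])) h0 h1
    set N := n + 1 with hN
    have hpos : 0 < lam ^ N := by positivity
    refine ⟨codingPartialSum lam p a N + lam ^ N • o, ?_, disjoint_left.2 ?_⟩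
    · have hdist : dist (codingPartialSum lam p a N + lam ^ N • o) x ≤ s / 2 := by
        rw [← hax, codingMap_eq_add h0 h1 p a N, dist_add_left, dist_eq_norm, ← smul_sub, norm_smul,
          Real.norm_of_nonneg hpos.le]
        calc _ ≤ s / (2 * D) * D := by
              gcongr
              · exact div_nonneg hs.1.le (by positivity)
              · exact (norm_sub_le _ _).trans
                  ((add_le_add_right (hC _) _).trans (le_max_right _ _))
          _ = s / 2 := by field_simp
      rw [mem_closedBall] at hxz ⊢
      linarith [dist_triangle (codingPartialSum lam p a N + lam ^ N • o) x z]
    · rintro w hw ⟨a', -, hunique⟩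
      set y : V := (lam ^ N)⁻¹ • (w - codingPartialSum lam p a N) with hy
      have hwy : w = codingPartialSum lam p a N + lam ^ N • y := by
        rw [hy, smul_inv_smul₀ hpos.ne', add_sub_cancel]
      have hyo : y ∈ closedBall o ρ := by
        rw [hwy, mem_closedBall, dist_add_left, dist_smul₀, Real.norm_of_nonneg hpos.le] at hw
        refine mem_closedBall.2 (le_of_mul_le_mul_left (hw.trans ?_) hpos)
        calc _ ≤ lam / (2 * D) * ρ * s := by
              gcongr
              · exact hs.1.le
              · exact min_le_right _ _
          _ = lam * (s / (2 * D)) * ρ := by ring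
          _ ≤ lam * lam ^ n * ρ := by gcongr
          _ = lam ^ N * ρ := by rw [hN, pow_succ']
      obtain ⟨b, c, hbc, hb, hc⟩ := ho y hyo
      refine hbc (prepend_injective a N ((hunique _ ?_).trans (hunique _ ?_).symm))
      · simp only [codingMap_prepend h0 h1, hb, hwy]
      · simp only [codingMap_prepend h0 h1, hc, hwy]

/-- A point with at least one but fewer than a continuum of addresses is the image, under a finite
composition of the maps, of a point with exactly one address. -/
lemma exists_eq_add_smul_of_mk_lt_continuum (h0 : 0 < lam) (h1 : lam < 1) (p : Fin m → V)
    {x : V} (hne : ∃ a, codingMap lam p a = x)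
    (hx : Cardinal.mk {a : ℕ → Fin m // x = codingMap lam p a} < Cardinal.continuum) :
    ∃ a N, ∃ y ∈ uniqueAddressSet lam p, x = codingPartialSum lam p a N + lam ^ N • y := by
  have hclosed : IsClosed {a : ℕ → Fin m | x = codingMap lam p a} :=
    isClosed_eq continuous_const (continuous_codingMap h0 h1 p)
  have hnot : ¬ Preperfect {a : ℕ → Fin m | x = codingMap lam p a} := by
    intro hpre
    let := TopologicalSpace.upgradeIsCompletelyMetrizable (ℕ → Fin m)
    obtain ⟨F, hF, -, hinj⟩ := Perfect.exists_nat_bool_injection ⟨hclosed, hpre⟩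
      (hne.imp fun _ h => h.symm)
    refine hx.not_ge ?_
    have hinj' : Function.Injective
        fun b => (⟨F b, hF (mem_range_self b)⟩ : {a : ℕ → Fin m // x = codingMap lam p a}) :=
      fun b c hbc => hinj (congrArg Subtype.val hbc)
    simpa using Cardinal.mk_le_of_injective hinj'
  simp only [Preperfect, accPt_iff_nhds, not_forall] at hnot
  obtain ⟨a, hax, U, hU, hiso⟩ := hnot
  obtain ⟨_, ⟨b, N, rfl⟩, hab, hNU⟩ :=
    (PiNat.isTopologicalBasis_cylinders fun _ : ℕ => Fin m).mem_nhds_iff.1 hU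
  rw [← PiNat.mem_cylinder_iff_eq.1 hab] at hNU
  refine ⟨a, N, codingMap lam p fun n => a (n + N), ⟨_, rfl, fun c hc => ?_⟩,
    (show x = _ from hax).trans (codingMap_eq_add h0 h1 p a N)⟩
  have hmem : prepend a N c ∈ U := hNU (PiNat.mem_cylinder_iff.2 fun n hn => by simp [prepend, hn])
  have hcx : x = codingMap lam p (prepend a N c) := by
    rw [codingMap_prepend h0 h1, hc, ← codingMap_eq_add h0 h1]
    exact hax
  have heq : prepend a N c = a := by
    by_contra hne
    exact hiso ⟨_, ⟨hmem, hcx⟩, hne⟩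
  funext n
  rw [← prepend_add a c N, heq]

lemma dimH_mk_lt_continuum_le (h0 : 0 < lam) (h1 : lam < 1) (p : Fin m → V) {S : Set V}
    (hS : ∀ x ∈ S, ∃ a, codingMap lam p a = x) :
    dimH {x ∈ S | Cardinal.mk {a : ℕ → Fin m // x = codingMap lam p a} < Cardinal.continuum} ≤
      dimH (uniqueAddressSet lam p) := by
  have hsub : {x ∈ S | Cardinal.mk {a : ℕ → Fin m // x = codingMap lam p a} < Cardinal.continuum} ⊆
      ⋃ N : ℕ, ⋃ t ∈ range fun a => codingPartialSum lam p a N,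
        (fun y => t + lam ^ N • y) '' uniqueAddressSet lam p := by
    rintro x ⟨hxS, hx⟩
    obtain ⟨a, N, y, hy, rfl⟩ := exists_eq_add_smul_of_mk_lt_continuum h0 h1 p (hS x hxS) hx
    simp only [mem_iUnion]
    exact ⟨N, _, mem_range_self a, mem_image_of_mem _ hy⟩
  refine (dimH_mono hsub).trans ?_
  rw [dimH_iUnion]
  refine iSup_le fun N => ?_
  rw [dimH_bUnion (countable_range_codingPartialSum lam p N)]
  refine iSup₂_le fun t _ => ?_
  refine LipschitzWith.dimH_image_le (K := ‖lam ^ N‖₊) (.of_dist_le_mul fun y z => ?_) _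
  rw [dist_add_left, dist_smul₀, coe_nnnorm]

omit [CompleteSpace V] in
lemma mk_addresses_le_continuum (p : Fin m → V) (x : V) :
    Cardinal.mk {a : ℕ → Fin m // x = codingMap lam p a} ≤ Cardinal.continuum := by
  refine (Cardinal.mk_subtype_le _).trans ?_
  calc Cardinal.mk (ℕ → Fin m) ≤ Cardinal.mk (ℕ → ℕ) :=
        Cardinal.mk_le_of_injective (f := fun a n => (a n : ℕ)) fun a b h => by
          funext n
          exact Fin.ext (congrFun h n)
    _ = Cardinal.continuum := by simp

end Coding

/-- **Main theorem.** If the attractor has no holes (`Ω = ⋃_j f_j(Ω)`) and a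
vertex of `f_k(Ω)` lies in the interior of `f_i(Ω)`, then the exceptional set
`V_λ` of points with fewer than a continuum of addresses has Hausdorff
dimension `< d`; in particular Lebesgue-a.e. `x ∈ Ω` has a continuum of
distinct addresses. -/
theorem stmt11 (d m : ℕ) (hd : 1 ≤ d) (hm : 2 ≤ m)
    (p : Fin m → EuclideanSpace ℝ (Fin d)) (hp : Function.Injective p)
    (lam : ℝ) (h0 : 0 < lam) (h1 : lam < 1)
    (f : Fin m → EuclideanSpace ℝ (Fin d) → EuclideanSpace ℝ (Fin d))
    (hf : ∀ j x, f j x = lam • x + (1 - lam) • p j)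
    (Ω : Set (EuclideanSpace ℝ (Fin d))) (hΩ : Ω = convexHull ℝ (Set.range p))
    (hint : (interior Ω).Nonempty)
    (hnoholes : Ω = ⋃ j, f j '' Ω)
    (i k : Fin m) (hik : i ≠ k) (j : Fin m)
    (hvertex : p j ∈ Set.extremePoints ℝ Ω)
    (hover : f k (p j) ∈ interior (f i '' Ω)) :
    dimH {x ∈ Ω | Cardinal.mk {a : ℕ → Fin m //
        x = (lam⁻¹ - 1) • ∑' n : ℕ, lam ^ (n + 1) • p (a n)} < Cardinal.continuum} < d ∧
    ∀ᵐ x ∂(volume : Measure (EuclideanSpace ℝ (Fin d))), x ∈ Ω →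
      Cardinal.mk {a : ℕ → Fin m //
        x = (lam⁻¹ - 1) • ∑' n : ℕ, lam ^ (n + 1) • p (a n)} = Cardinal.continuum := by
  change dimH {x ∈ Ω | Cardinal.mk {a : ℕ → Fin m // x = codingMap lam p a} <
      Cardinal.continuum} < d ∧
    ∀ᵐ x ∂(volume : Measure (EuclideanSpace ℝ (Fin d))), x ∈ Ω →
      Cardinal.mk {a : ℕ → Fin m // x = codingMap lam p a} = Cardinal.continuum
  have hbdd : Bornology.IsBounded Ω := by
    rw [hΩ]
    exact isBounded_convexHull.2 (finite_range p).isBounded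
  have haddr : ∀ x ∈ Ω, ∃ a, codingMap lam p a = x := by
    intro x hx
    refine exists_codingMap_eq h0 h1 p hbdd (fun x hx => ?_) hx
    rw [hnoholes] at hx
    obtain ⟨l, y, hy, rfl⟩ := mem_iUnion.1 hx
    exact ⟨l, y, hy, hf l y⟩
  have haddr' : ∀ l, ∀ x ∈ f l '' Ω, ∃ a, a 0 = l ∧ codingMap lam p a = x := by
    rintro l _ ⟨y, hy, rfl⟩
    obtain ⟨b, rfl⟩ := haddr y hy
    refine ⟨prepend (fun _ => l) 1 b, by simp [prepend], ?_⟩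
    rw [codingMap_prepend h0 h1, hf, codingPartialSum, add_comm]
    simp only [Finset.range_one, Finset.sum_singleton, zero_add, pow_one, smul_smul]
    congr 2
    field_simp
  obtain ⟨o, ho⟩ : (interior (f i '' Ω ∩ f k '' Ω)).Nonempty := by
    have hfk : Continuous (f k) := by
      rw [show f k = fun x => lam • x + (1 - lam) • p k from funext (hf k)]
      fun_prop
    have hconv : Convex ℝ Ω := hΩ ▸ convex_convexHull ℝ _
    have hpj : p j ∈ closure (interior Ω) := by
      rw [hconv.closure_interior_eq_closure_of_nonempty_interior hint]
      exact subset_closure hvertex.1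
    obtain ⟨y, hyi, hyΩ⟩ := mem_closure_iff.1 hpj _ (isOpen_interior.preimage hfk) hover
    have hopen : IsOpenMap (f k) := by
      rw [show f k = (fun x => x + (1 - lam) • p k) ∘ fun x => lam • x from funext (hf k)]
      exact (isOpenMap_add_right _).comp (isOpenMap_smul₀ h0.ne')
    refine ⟨f k y, ?_⟩
    rw [interior_inter]
    exact ⟨hyi, hopen.image_interior_subset _ (mem_image_of_mem _ hyΩ)⟩
  obtain ⟨ρ, hρ, hball⟩ := nhds_basis_closedBall.mem_iff.1 (mem_interior_iff_mem_nhds.1 ho)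
  obtain ⟨c, hc, hporous⟩ := exists_isUniformlyPorous_uniqueAddressSet h0 h1 p hρ fun y hy => by
    obtain ⟨b, hb, hby⟩ := haddr' i y (hball hy).1
    obtain ⟨c, hc, hcy⟩ := haddr' k y (hball hy).2
    exact ⟨b, c, fun h => hik (by rw [← hb, ← hc, h]), hby, hcy⟩
  have hrank : Module.finrank ℝ (EuclideanSpace ℝ (Fin d)) = d := by simp
  have : Nontrivial (EuclideanSpace ℝ (Fin d)) :=
    Module.nontrivial_of_finrank_pos (R := ℝ) (by omega)
  have hdim := (dimH_mk_lt_continuum_le h0 h1 p haddr).trans_lt (hporous.dimH_lt_finrank hc)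
  refine ⟨by rwa [hrank] at hdim, ?_⟩
  have hac : (volume : Measure (EuclideanSpace ℝ (Fin d))) ≪
      Measure.hausdorffMeasure (Module.finrank ℝ (EuclideanSpace ℝ (Fin d)) : NNReal) := by
    rw [NNReal.coe_natCast]
    exact Measure.absolutelyContinuous_isAddHaarMeasure _ _
  filter_upwards [measure_eq_zero_iff_ae_notMem.1 (measure_zero_of_dimH_lt hac
    (by exact_mod_cast hdim))] with x hx hxΩ
  exact (mk_addresses_le_continuum p x).antisymm (not_lt.1 fun h => hx ⟨hxΩ, h⟩)
end

section
/- Let m ≥ 2 and let A = {a_1,…,a_m} ⊂ ℝ with a_1 < a_2 < … < a_m. There exists λ_0 = λ_0(a_1,…,a_m) < 1 such that for every λ ∈ (λ_0, 1) and every x in the open interval (λa_1/(1−λ), λa_m/(1−λ)), the set of sequences (ε_n)_{n≥1} ∈ A^ℕ with x = ∑_{n=1}^∞ ε_n λ^n has cardinality 2^ℵ₀. -/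
/-- **Kakeya's criterion**: if every term of a nonnegative convergent series is at most the sum of
the terms following it, then every number between `0` and the sum of the series is the sum of a
subseries. -/
theorem exists_hasSum_subseries {c : ℕ → ℝ} (hc : Summable c) (h0 : ∀ n, 0 ≤ c n)
    (htail : ∀ n, c n ≤ ∑' k, c (k + (n + 1))) {y : ℝ} (hy0 : 0 ≤ y) (hy : y ≤ ∑' n, c n) :
    ∃ δ : ℕ → Bool, HasSum (fun n => if δ n then c n else 0) y := by
  let r : ℕ → ℝ := fun n => Nat.rec (motive := fun _ => ℝ) y (fun k (s : ℝ) => s - if c k ≤ s then c k else 0) n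
  have r_succ (n : ℕ) : r (n + 1) = r n - (if c n ≤ r n then c n else 0) := rfl
  have tail_eq (n : ℕ) : ∑' k, c (k + n) = c n + ∑' k, c (k + (n + 1)) := by
    rw [((summable_nat_add_iff n).2 hc).tsum_eq_zero_add]
    simp [add_assoc, add_comm 1 n]
  have bounds (n : ℕ) : 0 ≤ r n ∧ r n ≤ ∑' k, c (k + n) := by
    induction n with
    | zero => exact ⟨hy0, hy⟩
    | succ n ih =>
      rw [tail_eq n] at ih
      have := htail n
      rw [r_succ]
      split_ifs <;> constructor <;> linarith
  have r_lim : Filter.Tendsto r Filter.atTop (nhds 0) :=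
    squeeze_zero (fun n => (bounds n).1) (fun n => (bounds n).2) (tendsto_sum_nat_add c)
  have partial_sum (n : ℕ) :
      ∑ k ∈ Finset.range n, (if c k ≤ r k then c k else 0) = y - r n := by
    induction n with
    | zero => simp [r]
    | succ n ih => rw [Finset.sum_range_succ, ih, r_succ]; ring
  refine ⟨fun n => decide (c n ≤ r n), ?_⟩
  simp only [decide_eq_true_eq]
  rw [hasSum_iff_tendsto_nat_of_nonneg (fun n => by split_ifs <;> simp [h0])]
  simp only [partial_sum]
  simpa using r_lim.const_sub y

/-- For `3/4 < q < 1`, the number `y` has expansions `∑ δ n * q ^ (n + 1)` whose binary digits at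
infinitely many fixed places are prescribed arbitrarily. -/
theorem exists_binary_expansion_of_prescribed_digits {q : ℝ} (hq : 3 / 4 < q) (hq1 : q < 1)
    {y : ℝ} (hy0 : 0 < y) (hy : y < q / (1 - q)) :
    ∃ M : ℕ, ∀ b : ℕ → Bool, ∃ δ : ℕ → Bool, (∀ k, δ (4 * (M + k)) = b k) ∧
      HasSum (fun n => if δ n then q ^ (n + 1) else 0) y := by
  have hq0 : 0 < q := by linarith
  have geom : HasSum (fun n => q ^ (n + 1)) (q / (1 - q)) := by
    simpa [pow_succ', div_eq_mul_inv] using (hasSum_geometric_of_lt_one hq0.le hq1).mul_left q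
  obtain ⟨M, hM⟩ : ∃ M : ℕ, ∑' k, q ^ (k + 4 * M + 1) < min y (q / (1 - q) - y) := by
    have lim := (tendsto_sum_nat_add fun n => q ^ (n + 1)).comp
      (Filter.tendsto_id.const_mul_atTop' (by norm_num : 0 < 4))
    exact (lim.eventually (gt_mem_nhds (lt_min hy0 (by linarith)))).exists
  have hM1 := hM.trans_le (min_le_left _ _)
  have hM2 := hM.trans_le (min_le_right _ _)
  let S : ℕ → Prop := fun n => n % 4 = 0 ∧ 4 * M ≤ n
  let c : ℕ → ℝ := fun n => if S n then 0 else q ^ (n + 1)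
  let d : ℕ → ℝ := fun n => if S n then q ^ (n + 1) else 0
  have c_nonneg (n : ℕ) : 0 ≤ c n := by dsimp only [c]; split_ifs <;> positivity
  have d_nonneg (n : ℕ) : 0 ≤ d n := by dsimp only [d]; split_ifs <;> positivity
  have c_add_d (n : ℕ) : c n + d n = q ^ (n + 1) := by dsimp only [c, d]; split_ifs <;> simp
  have c_sum : Summable c :=
    geom.summable.of_nonneg_of_le c_nonneg fun n => by linarith [c_add_d n, d_nonneg n]
  have d_sum : Summable d :=
    geom.summable.of_nonneg_of_le d_nonneg fun n => by linarith [c_add_d n, c_nonneg n]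
  have total : ∑' n, c n + ∑' n, d n = q / (1 - q) := by
    rw [← c_sum.tsum_add d_sum, ← geom.tsum_eq]
    exact tsum_congr c_add_d
  have d_small : ∑' n, d n ≤ ∑' k, q ^ (k + 4 * M + 1) := by
    rw [← d_sum.sum_add_tsum_nat_add (4 * M), Finset.sum_eq_zero, zero_add]
    · have le (n : ℕ) : d (n + 4 * M) ≤ q ^ (n + 4 * M + 1) := by
        linarith [c_add_d (n + 4 * M), c_nonneg (n + 4 * M)]
      exact Summable.tsum_le_tsum le ((summable_nat_add_iff (4 * M)).2 d_sum)
        ((summable_nat_add_iff (f := fun n => q ^ (n + 1)) (4 * M)).2 geom.summable)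
    · intro n hn
      have : ¬ S n := fun h => absurd (Finset.mem_range.1 hn) (by have := h.2; omega)
      simp [d, this]
  have pow_bound : 1 ≤ q ^ 2 + q ^ 3 + q ^ 4 := by
    have h2 : (3 / 4 : ℝ) ^ 2 ≤ q ^ 2 := by gcongr
    have h3 : (3 / 4 : ℝ) ^ 3 ≤ q ^ 3 := by gcongr
    have h4 : (3 / 4 : ℝ) ^ 4 ≤ q ^ 4 := by gcongr
    norm_num at h2 h3 h4
    linarith
  have c_tail (n : ℕ) : c n ≤ ∑' k, c (k + (n + 1)) := by
    have four_le := ((summable_nat_add_iff (n + 1)).2 c_sum).sum_le_tsum (Finset.range 4)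
      fun k _ => c_nonneg _
    refine le_trans ?_ four_le
    have c_le : c n ≤ q ^ (n + 1) := by linarith [c_add_d n, d_nonneg n]
    have hpow : 0 < q ^ (n + 1) := by positivity
    have one_le : q ^ (n + 1) * 1 ≤ q ^ (n + 1) * (q ^ 2 + q ^ 3 + q ^ 4) := by gcongr
    have q2 : q ^ 2 ≤ q := by nlinarith
    have q3 : q ^ 3 ≤ q ^ 2 := by nlinarith [sq_nonneg q]
    have q4 : q ^ 4 ≤ q ^ 3 := by nlinarith [pow_pos hq0 3]
    have c_shift (i : ℕ) (hi : ¬ S (i + (n + 1))) :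
        c (i + (n + 1)) = q ^ (n + 1) * q ^ (i + 1) := by
      simp only [c, if_neg hi]; ring
    simp only [Finset.sum_range_succ, Finset.sum_range_zero, zero_add]
    have c0 := c_shift 0
    have c1 := c_shift 1
    have c2 := c_shift 2
    have c3 := c_shift 3
    simp only [zero_add, pow_one, Nat.reduceAdd] at c0 c1 c2 c3
    have n0 := c_nonneg (n + 1)
    have n1 := c_nonneg (1 + (n + 1))
    have n2 := c_nonneg (2 + (n + 1))
    have n3 := c_nonneg (3 + (n + 1))
    have m2 := mul_le_mul_of_nonneg_left q2 hpow.le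
    have m3 := mul_le_mul_of_nonneg_left q3 hpow.le
    have m4 := mul_le_mul_of_nonneg_left q4 hpow.le
    have cases : n % 4 = 0 ∨ n % 4 = 1 ∨ n % 4 = 2 ∨ n % 4 = 3 := by omega
    rcases cases with h | h | h | h
    · rw [c0 (by dsimp only [S]; omega), c1 (by dsimp only [S]; omega),
        c2 (by dsimp only [S]; omega)]
      linarith
    · rw [c0 (by dsimp only [S]; omega), c1 (by dsimp only [S]; omega),
        c3 (by dsimp only [S]; omega)]
      linarith
    · rw [c0 (by dsimp only [S]; omega), c2 (by dsimp only [S]; omega),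
        c3 (by dsimp only [S]; omega)]
      linarith
    · rw [c1 (by dsimp only [S]; omega), c2 (by dsimp only [S]; omega),
        c3 (by dsimp only [S]; omega)]
      linarith
  refine ⟨M, fun b => ?_⟩
  let e : ℕ → ℝ := fun n => if b (n / 4 - M) then d n else 0
  have e_nonneg (n : ℕ) : 0 ≤ e n := by dsimp only [e]; split_ifs <;> simp [d_nonneg]
  have e_le (n : ℕ) : e n ≤ d n := by dsimp only [e]; split_ifs <;> simp [d_nonneg]
  have e_sum : Summable e := d_sum.of_nonneg_of_le e_nonneg e_le
  have e_tsum_le : ∑' n, e n ≤ ∑' n, d n := e_sum.tsum_le_tsum e_le d_sum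
  have e_tsum_nonneg : 0 ≤ ∑' n, e n := tsum_nonneg e_nonneg
  obtain ⟨δ, hδ⟩ := exists_hasSum_subseries c_sum c_nonneg c_tail (y := y - ∑' n, e n)
    (by linarith) (by linarith)
  refine ⟨fun n => if S n then b (n / 4 - M) else δ n, fun k => ?_, ?_⟩
  · have : S (4 * (M + k)) := ⟨by omega, by omega⟩
    simp [this]
  · have := hδ.add e_sum.hasSum
    rw [sub_add_cancel] at this
    convert this using 2 with n
    by_cases hS : S n <;> simp [c, d, e, hS]

/-- Expansions with deleted digits: for any digit set `a_1 < … < a_m` there is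
`λ_0 < 1` such that for all `λ ∈ (λ_0, 1)`, every
`x ∈ (λa_1/(1−λ), λa_m/(1−λ))` has a continuum of expansions
`x = ∑_{n≥1} ε_n λ^n` with digits `ε_n ∈ {a_1,…,a_m}`. -/
theorem stmt12 (m : ℕ) (hm : 2 ≤ m) (a : Fin m → ℝ) (ha : StrictMono a) :
    ∃ lam0 : ℝ, 0 < lam0 ∧ lam0 < 1 ∧ ∀ lam : ℝ, lam0 < lam → lam < 1 →
      ∀ x ∈ Set.Ioo (lam * a ⟨0, by omega⟩ / (1 - lam))
          (lam * a ⟨m - 1, by omega⟩ / (1 - lam)),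
        Cardinal.mk {ε : ℕ → Fin m //
          x = ∑' n : ℕ, a (ε n) * lam ^ (n + 1)} = Cardinal.continuum := by
  refine ⟨3 / 4, by norm_num, by norm_num, fun q hq hq1 x hx => ?_⟩
  set i : Fin m := ⟨0, by omega⟩
  set j : Fin m := ⟨m - 1, by omega⟩
  have hij : i < j := Fin.mk_lt_mk.2 (by omega)
  have gap : 0 < a j - a i := sub_pos.2 (ha hij)
  have hq0 : 0 < q := by linarith
  have geom : HasSum (fun n => q ^ (n + 1)) (q / (1 - q)) := by
    simpa [pow_succ', div_eq_mul_inv] using (hasSum_geometric_of_lt_one hq0.le hq1).mul_left q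
  have lower : a i * (q / (1 - q)) < x := by rw [← mul_div_assoc, mul_comm]; exact hx.1
  have upper : x < a j * (q / (1 - q)) := by rw [← mul_div_assoc, mul_comm]; exact hx.2
  obtain ⟨M, hM⟩ := exists_binary_expansion_of_prescribed_digits hq hq1
    (y := (x - a i * (q / (1 - q))) / (a j - a i)) (div_pos (by linarith) gap)
    (by rw [div_lt_iff₀ gap]; linarith)
  choose δ hδ hsum using hM
  apply le_antisymm
  · refine (Cardinal.mk_subtype_le _).trans ?_
    rw [← Cardinal.power_def, Cardinal.mk_nat, ← Cardinal.aleph0_power_aleph0]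
    exact Cardinal.power_le_power_right Cardinal.mk_le_aleph0
  · have expansion (b : ℕ → Bool) :
        x = ∑' n : ℕ, a (if δ b n then j else i) * q ^ (n + 1) := by
      have h := (geom.mul_left (a i)).add ((hsum b).mul_left (a j - a i))
      rw [mul_div_cancel₀ _ gap.ne', add_sub_cancel] at h
      rw [← h.tsum_eq]
      refine tsum_congr fun n => ?_
      split_ifs <;> ring
    have inj : Function.Injective fun b : ℕ → Bool =>
        (⟨fun n => if δ b n then j else i, expansion b⟩ :
          {ε : ℕ → Fin m // x = ∑' n : ℕ, a (ε n) * q ^ (n + 1)}) := by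
      intro b b' h
      funext k
      have hk := congrFun (Subtype.ext_iff.1 h) (4 * (M + k))
      simp only [hδ] at hk
      revert hk
      cases b k <;> cases b' k <;> simp [hij.ne, hij.ne']
    have := Cardinal.mk_le_of_injective inj
    rwa [← Cardinal.power_def, Cardinal.mk_bool, Cardinal.mk_nat,
      Cardinal.two_power_aleph0] at this
end

section
/- Let m ≥ 2, A = {a_1,…,a_m} ⊂ ℝ with a_1 < … < a_m, and λ ∈ (0,1). Assume Pedicini's condition: max_{1≤j≤m−1}(a_{j+1} − a_j) < λ(a_m − a_1)/(1−λ). Then the set of x ∈ (λa_1/(1−λ), λa_m/(1−λ)) for which the set of sequences (ε_n)_{n≥1} ∈ A^ℕ with x = ∑_{n=1}^∞ ε_n λ^n has cardinality strictly less than 2^ℵ₀ has Hausdorff dimension strictly less than 1; in particular, Lebesgue-almost every x in this interval has 2^ℵ₀ such expansions. -/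
open MeasureTheory

/-- `U` is (lower) porous with constant `κ` at all scales up to `D`. -/
def PorousUpTo (U : Set ℝ) (κ D : ℝ) : Prop :=
  ∀ x ∈ U, ∀ r, 0 < r → r ≤ D →
    ∃ u, x - r ≤ u ∧ u + κ * r ≤ x + r ∧ Disjoint (Set.Icc u (u + κ * r)) U

/-- A subinterval of length at least `2ℓ/k` contains a cell of the subdivision of
`[t, t + ℓ]` into `k` equal parts. -/
lemma exists_cell_subset {k : ℕ} {t ℓ u v : ℝ} (hk : 0 < k) (hℓ : 0 < ℓ) (hu : t ≤ u)
    (hv : v ≤ t + ℓ) (huv : 2 * (ℓ / k) ≤ v - u) :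
    ∃ j < k, Set.Icc (t + j * (ℓ / k)) (t + j * (ℓ / k) + ℓ / k) ⊆ Set.Icc u v := by
  have hk' : (0 : ℝ) < k := by exact_mod_cast hk
  set δ := ℓ / k with hδ
  have hδ0 : 0 < δ := by positivity
  have hkδ : k * δ = ℓ := by rw [hδ]; field_simp
  have hnn : 0 ≤ (u - t) / δ := div_nonneg (by linarith) hδ0.le
  have h1 := Nat.le_ceil ((u - t) / δ)
  have h2 := Nat.ceil_lt_add_one hnn
  rw [div_le_iff₀ hδ0] at h1
  have h3 : (⌈(u - t) / δ⌉₊ : ℝ) * δ < u - t + δ := by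
    calc (⌈(u - t) / δ⌉₊ : ℝ) * δ < ((u - t) / δ + 1) * δ := by gcongr
      _ = u - t + δ := by field_simp
  refine ⟨⌈(u - t) / δ⌉₊, ?_, Set.Icc_subset_Icc (by linarith) (by linarith)⟩
  have h4 : (⌈(u - t) / δ⌉₊ : ℝ) * δ < k * δ := by linarith
  exact_mod_cast lt_of_mul_lt_mul_right h4 hδ0.le

lemma PorousUpTo.exists_cell_disjoint {U : Set ℝ} {κ D : ℝ} (hU : PorousUpTo U κ D)
    {k : ℕ} (hk6 : 6 ≤ k) (hk : 6 ≤ κ * k) {t ℓ : ℝ} (hℓ : 0 < ℓ) (hD : ℓ ≤ D) :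
    ∃ j < k, Disjoint (Set.Icc (t + j * (ℓ / k)) (t + j * (ℓ / k) + ℓ / k)) U := by
  have hk6' : (6 : ℝ) ≤ k := by exact_mod_cast hk6
  have hk0 : (0 : ℝ) < k := by linarith
  by_cases hmid : Disjoint (Set.Icc (t + ℓ / 3) (t + 2 * ℓ / 3)) U
  · obtain ⟨j, hj, hsub⟩ := exists_cell_subset (k := k) (t := t) (ℓ := ℓ) (u := t + ℓ / 3)
      (v := t + 2 * ℓ / 3) (by omega) hℓ (by linarith) (by linarith) (by
        have : ℓ / k ≤ ℓ / 6 := by gcongr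
        linarith)
    exact ⟨j, hj, hmid.mono_left hsub⟩
  · obtain ⟨x, hx, hxU⟩ := Set.not_disjoint_iff.1 hmid
    obtain ⟨u, hu, hv, hdis⟩ := hU x hxU (ℓ / 3) (by positivity) (by linarith)
    obtain ⟨j, hj, hsub⟩ := exists_cell_subset (k := k) (t := t) (ℓ := ℓ) (u := u)
      (v := u + κ * (ℓ / 3)) (by omega) hℓ (by linarith [hx.1]) (by linarith [hx.2]) (by
        have : 2 * (ℓ / k) ≤ κ * (ℓ / 3) := by
          rw [← mul_div_assoc, div_le_iff₀ hk0]
          nlinarith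
        linarith)
    exact ⟨j, hj, hdis.mono_left hsub⟩

lemma PorousUpTo.exists_cover {U : Set ℝ} {κ D : ℝ} (hU : PorousUpTo U κ D) (hD : 0 < D)
    {k : ℕ} (hk6 : 6 ≤ k) (hk : 6 ≤ κ * k) {t : ℝ} (ht : U ⊆ Set.Icc t (t + D)) (n : ℕ) :
    ∃ s : Finset ℝ, s.card ≤ (k - 1) ^ n ∧
      U ⊆ ⋃ x : s, Set.Icc (x : ℝ) (x + D / (k : ℝ) ^ n) := by
  have hk1 : (1 : ℝ) ≤ k := by exact_mod_cast (by omega : 1 ≤ k)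
  have hk0 : (0 : ℝ) < k := by linarith
  induction n with
  | zero => exact ⟨{t}, by simp, fun y hy => Set.mem_iUnion.2 ⟨⟨t, by simp⟩, by simpa using ht hy⟩⟩
  | succ n ih =>
    obtain ⟨s, hs, hcov⟩ := ih
    have hℓ : 0 < D / (k : ℝ) ^ n := by positivity
    have hle : D / (k : ℝ) ^ n ≤ D := div_le_self hD.le (one_le_pow₀ hk1)
    choose j hj hdis using fun x : ℝ => hU.exists_cell_disjoint hk6 hk (t := x) hℓ hle
    have hpow : D / (k : ℝ) ^ (n + 1) = D / (k : ℝ) ^ n / k := by rw [pow_succ, div_div]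
    rw [hpow]
    set ℓ := D / (k : ℝ) ^ n
    refine ⟨s.biUnion fun x => ((Finset.range k).erase (j x)).image fun i : ℕ =>
      x + i * (ℓ / k), ?_, ?_⟩
    · refine (Finset.card_biUnion_le_card_mul _ _ (k - 1) fun x _ => ?_).trans ?_
      · refine Finset.card_image_le.trans ?_
        rw [Finset.card_erase_of_mem (Finset.mem_range.2 (hj x)), Finset.card_range]
      · rw [pow_succ]; gcongr
    · intro y hy
      obtain ⟨⟨x, hx⟩, hyx⟩ := Set.mem_iUnion.1 (hcov hy)
      simp only at hyx
      have hδ : 0 < ℓ / k := by positivity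
      have hkδ : k * (ℓ / k) = ℓ := by field_simp
      obtain ⟨i, hi, hyi⟩ : ∃ i < k, y ∈ Set.Icc (x + i * (ℓ / k)) (x + i * (ℓ / k) + ℓ / k) := by
        rcases hyx.2.lt_or_eq with hlt | heq
        · have hnn : 0 ≤ (y - x) / (ℓ / k) := div_nonneg (by linarith [hyx.1]) hδ.le
          have h1 := Nat.floor_le hnn
          have h2 := Nat.lt_floor_add_one ((y - x) / (ℓ / k))
          rw [le_div_iff₀ hδ] at h1
          rw [div_lt_iff₀ hδ] at h2
          refine ⟨⌊(y - x) / (ℓ / k)⌋₊, ?_, by linarith, by linarith⟩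
          have h3 : (⌊(y - x) / (ℓ / k)⌋₊ : ℝ) * (ℓ / k) < k * (ℓ / k) := by linarith
          exact_mod_cast lt_of_mul_lt_mul_right h3 hδ.le
        · have hc : ((k - 1 : ℕ) : ℝ) = k - 1 := by push_cast [show 1 ≤ k by omega]; ring
          refine ⟨k - 1, by omega, ?_, ?_⟩ <;> rw [hc] <;> linarith
      have hij : i ≠ j x := by
        rintro rfl
        exact Set.disjoint_left.1 (hdis x) hyi hy
      refine Set.mem_iUnion.2 ⟨⟨x + i * (ℓ / k), ?_⟩, hyi⟩
      exact Finset.mem_biUnion.2 ⟨x, hx, Finset.mem_image.2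
        ⟨i, Finset.mem_erase.2 ⟨hij, Finset.mem_range.2 hi⟩, rfl⟩⟩

/-- A bounded porous subset of the line has Hausdorff dimension less than one. -/
lemma PorousUpTo.dimH_lt_one {U : Set ℝ} {κ D : ℝ} (hU : PorousUpTo U κ D) (hD : 0 < D)
    (hκ : 0 < κ) {t : ℝ} (ht : U ⊆ Set.Icc t (t + D)) : dimH U < 1 := by
  obtain ⟨k, hk6, hk⟩ : ∃ k : ℕ, 6 ≤ k ∧ 6 ≤ κ * k := by
    obtain ⟨k₀, hk₀⟩ := exists_nat_ge (6 / κ)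
    have : (k₀ : ℝ) ≤ (max 6 k₀ : ℕ) := by exact_mod_cast le_max_right _ _
    rw [div_le_iff₀ hκ] at hk₀
    exact ⟨max 6 k₀, le_max_left _ _, by nlinarith⟩
  have hk6' : (6 : ℝ) ≤ k := by exact_mod_cast hk6
  have hk0 : (0 : ℝ) < k := by linarith
  choose s hs hcov using hU.exists_cover hD hk6 hk ht
  obtain ⟨d, hd1, hkd⟩ : ∃ d : NNReal, d < 1 ∧ (k : ℝ) ^ (d : ℝ) = k - 1 := by
    have hlog : 0 < Real.log k := Real.log_pos (by linarith)
    refine ⟨.mk (Real.log (k - 1) / Real.log k)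
      (div_nonneg (Real.log_nonneg (by linarith)) hlog.le), ?_, ?_⟩
    · rw [← NNReal.coe_lt_coe]
      exact (div_lt_one hlog).2 (Real.log_lt_log (by linarith) (by linarith))
    · rw [NNReal.coe_mk, Real.rpow_def_of_pos hk0, mul_div_cancel₀ _ hlog.ne',
        Real.exp_log (by linarith)]
  have hsum (n : ℕ) : ∑ i : s n, Metric.ediam (Set.Icc (i : ℝ) (i + D / (k : ℝ) ^ n)) ^ (d : ℝ)
      ≤ ENNReal.ofReal (D ^ (d : ℝ)) := by
    have hpos : 0 ≤ D / (k : ℝ) ^ n := by positivity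
    simp only [Real.ediam_Icc, add_sub_cancel_left, Finset.sum_const, Finset.card_univ,
      Fintype.card_coe, nsmul_eq_mul]
    rw [ENNReal.ofReal_rpow_of_nonneg hpos d.coe_nonneg, ← ENNReal.ofReal_natCast,
      ← ENNReal.ofReal_mul (by positivity)]
    apply ENNReal.ofReal_le_ofReal
    have hc : ((k - 1 : ℕ) : ℝ) = k - 1 := by push_cast [show 1 ≤ k by omega]; ring
    have hcard : ((s n).card : ℝ) ≤ (k - 1) ^ n := by rw [← hc]; exact_mod_cast hs n
    have hk1 : (0 : ℝ) < k - 1 := by linarith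
    rw [Real.div_rpow hD.le (by positivity), ← Real.rpow_natCast (k : ℝ) n, ← Real.rpow_mul hk0.le,
      mul_comm (n : ℝ), Real.rpow_mul hk0.le, hkd, Real.rpow_natCast, ← mul_div_assoc,
      div_le_iff₀ (by positivity), mul_comm]
    gcongr
  have hr : Filter.Tendsto (fun n : ℕ => ENNReal.ofReal (D / (k : ℝ) ^ n)) Filter.atTop
      (nhds 0) := by
    rw [← ENNReal.ofReal_zero]
    refine ENNReal.tendsto_ofReal (tendsto_const_nhds.div_atTop ?_)
    exact tendsto_pow_atTop_atTop_of_one_lt (by linarith)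
  have hμ : Measure.hausdorffMeasure (d : ℝ) U ≤ ENNReal.ofReal (D ^ (d : ℝ)) :=
    (Measure.hausdorffMeasure_le_liminf_sum (d : ℝ) U _ hr
      (fun n (i : s n) => Set.Icc (i : ℝ) (i + D / (k : ℝ) ^ n))
      (.of_forall fun n i => by simp [Real.ediam_Icc]) (.of_forall hcov)).trans
      ((Filter.liminf_le_liminf (.of_forall hsum)).trans_eq (by simp))
  refine (dimH_le_of_hausdorffMeasure_ne_top
    (ne_top_of_le_ne_top ENNReal.ofReal_ne_top hμ)).trans_lt ?_
  exact_mod_cast hd1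

/-- The value `∑_{n ≥ 1} a(ε_n) λ^n` of a digit sequence, indexed from `0`. -/
noncomputable def digitValue {ι : Type*} (a : ι → ℝ) (lam : ℝ) (ε : ℕ → ι) : ℝ :=
  ∑' n : ℕ, a (ε n) * lam ^ (n + 1)

/-- The sequence consisting of the first `n` terms of `ε` followed by `η`. -/
def splice {ι : Type*} (n : ℕ) (ε η : ℕ → ι) : ℕ → ι :=
  fun i => if i < n then ε i else η (i - n)

lemma splice_injective {ι : Type*} (n : ℕ) (ε : ℕ → ι) : Function.Injective (splice n ε) := by
  intro η₁ η₂ h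
  funext i
  simpa [splice] using congrFun h (i + n)

section DigitValue

variable {ι : Type*} [Finite ι] {a : ι → ℝ} {lam : ℝ}

lemma exists_digit_bound (h0 : 0 < lam) (h1 : lam < 1) :
    ∃ u : ℕ → ℝ, Summable u ∧ ∀ n (ε : ℕ → ι), ‖a (ε n) * lam ^ (n + 1)‖ ≤ u n := by
  obtain ⟨C, hC⟩ := (Set.finite_range fun i => ‖a i‖).bddAbove
  refine ⟨fun n => C * lam ^ (n + 1),
    ((summable_nat_add_iff 1).2 (summable_geometric_of_lt_one h0.le h1)).mul_left C, ?_⟩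
  intro n ε
  rw [norm_mul, Real.norm_of_nonneg (pow_nonneg h0.le _)]
  exact mul_le_mul_of_nonneg_right (hC ⟨ε n, rfl⟩) (pow_nonneg h0.le _)

lemma summable_digits (h0 : 0 < lam) (h1 : lam < 1) (ε : ℕ → ι) :
    Summable fun n : ℕ => a (ε n) * lam ^ (n + 1) := by
  obtain ⟨u, hu, hb⟩ := exists_digit_bound (a := a) h0 h1
  exact hu.of_norm_bounded fun n => hb n ε

lemma continuous_digitValue [TopologicalSpace ι] [DiscreteTopology ι]
    (h0 : 0 < lam) (h1 : lam < 1) : Continuous (digitValue a lam) := by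
  obtain ⟨u, hu, hb⟩ := exists_digit_bound (a := a) h0 h1
  refine continuous_tsum (fun n => ?_) hu hb
  exact (continuous_of_discreteTopology.comp (continuous_apply n)).mul continuous_const

lemma digitValue_eq_add (h0 : 0 < lam) (h1 : lam < 1) (n : ℕ) (ε : ℕ → ι) :
    digitValue a lam ε = ∑ i ∈ Finset.range n, a (ε i) * lam ^ (i + 1) +
      lam ^ n * digitValue a lam (fun i => ε (i + n)) := by
  rw [digitValue, ← (summable_digits h0 h1 ε).sum_add_tsum_nat_add n, digitValue, ← tsum_mul_left]
  congr 2
  funext i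
  ring

lemma digitValue_splice (h0 : 0 < lam) (h1 : lam < 1) (n : ℕ) (ε η : ℕ → ι) :
    digitValue a lam (splice n ε η) = ∑ i ∈ Finset.range n, a (ε i) * lam ^ (i + 1) +
      lam ^ n * digitValue a lam η := by
  rw [digitValue_eq_add h0 h1 n]
  congr 1
  · refine Finset.sum_congr rfl fun i hi => ?_
    simp [splice, Finset.mem_range.1 hi]
  · simp [splice]

/-- If every point of some nondegenerate interval has two expansions, then the points with a
unique expansion form a set of dimension less than one. -/
lemma dimH_existsUnique_lt_one (h0 : 0 < lam) (h1 : lam < 1) {L R p c : ℝ}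
    (hmem : ∀ ε, digitValue a lam ε ∈ Set.Icc L R) (hc : 0 < c) (hLp : L ≤ p) (hpR : p + c ≤ R)
    (hdouble : ∀ y ∈ Set.Icc p (p + c), ∃ η₁ η₂, η₁ ≠ η₂ ∧
      digitValue a lam η₁ = y ∧ digitValue a lam η₂ = y) :
    dimH {x | ∃! ε, digitValue a lam ε = x} < 1 := by
  have hD : 0 < R - L := by linarith
  have hpor : PorousUpTo {x | ∃! ε, digitValue a lam ε = x} (c * lam / (R - L)) (R - L) := by
    rintro x ⟨ε, rfl, -⟩ r hr hrD
    obtain ⟨n, hn1, hn2⟩ := exists_nat_pow_near_of_lt_one (div_pos hr hD)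
      ((div_le_one hD).2 hrD) h0 h1
    rw [lt_div_iff₀ hD] at hn1
    rw [div_le_iff₀ hD] at hn2
    have hP : 0 < lam ^ (n + 1) := pow_pos h0 _
    have hκ : c * lam / (R - L) * r ≤ lam ^ (n + 1) * c := by
      rw [div_mul_eq_mul_div, div_le_iff₀ hD, pow_succ]
      nlinarith [mul_le_mul_of_nonneg_left hn2 (mul_pos hc h0).le]
    have hz := hmem fun i => ε (i + (n + 1))
    have hx := digitValue_eq_add (a := a) h0 h1 (n + 1) ε
    set z := digitValue a lam fun i => ε (i + (n + 1))
    set S := ∑ i ∈ Finset.range (n + 1), a (ε i) * lam ^ (i + 1) with hS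
    refine ⟨S + lam ^ (n + 1) * p, ?_, ?_, ?_⟩
    · nlinarith [hz.2]
    · nlinarith [hz.1]
    · rw [Set.disjoint_left]
      rintro y hy ⟨ζ, -, hζ⟩
      have hy' : (y - S) / lam ^ (n + 1) ∈ Set.Icc p (p + c) := by
        constructor
        · rw [le_div_iff₀ hP]; linarith [hy.1]
        · rw [div_le_iff₀ hP]; linarith [hy.2]
      obtain ⟨η₁, η₂, hne, e₁, e₂⟩ := hdouble _ hy'
      have key (η) (e : digitValue a lam η = (y - S) / lam ^ (n + 1)) :
          digitValue a lam (splice (n + 1) ε η) = y := by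
        rw [digitValue_splice h0 h1, e, ← hS]
        field_simp
        ring
      exact hne (splice_injective (n + 1) ε ((hζ _ (key η₁ e₁)).trans (hζ _ (key η₂ e₂)).symm))
  refine hpor.dimH_lt_one hD (by positivity) (t := L) ?_
  rintro x ⟨ε, rfl, -⟩
  simpa using hmem ε

/-- A point with an expansion but fewer than a continuum of them has an expansion with a tail
whose value has a unique expansion. -/
lemma exists_tail_existsUnique (h0 : 0 < lam) (h1 : lam < 1) {x : ℝ}
    (hx : ∃ ε, digitValue a lam ε = x)
    (hcard : Cardinal.mk {ε : ℕ → ι // x = digitValue a lam ε} < Cardinal.continuum) :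
    ∃ (n : ℕ) (ε : ℕ → ι), digitValue a lam ε = x ∧
      ∃! η, digitValue a lam η = digitValue a lam fun i => ε (i + n) := by
  let : TopologicalSpace ι := ⊥
  have : DiscreteTopology ι := ⟨rfl⟩
  let := TopologicalSpace.upgradeIsCompletelyMetrizable (ℕ → ι)
  by_contra! hcon
  have hclosed : IsClosed {ε : ℕ → ι | x = digitValue a lam ε} :=
    isClosed_eq continuous_const (continuous_digitValue h0 h1)
  have hperf : Perfect {ε : ℕ → ι | x = digitValue a lam ε} := by
    refine ⟨hclosed, preperfect_iff_nhds.2 fun ε hε V hV => ?_⟩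
    obtain ⟨W, ⟨ε', n, rfl⟩, hεW, hWV⟩ :=
      (PiNat.isTopologicalBasis_cylinders fun _ : ℕ => ι).mem_nhds_iff.1 hV
    have hnu := hcon n ε hε.symm
    obtain ⟨η, hη, hne⟩ : ∃ η, digitValue a lam η = digitValue a lam (fun i => ε (i + n)) ∧
        η ≠ fun i => ε (i + n) := by
      by_contra! h
      exact hnu ⟨_, rfl, h⟩
    refine ⟨splice n ε η, ⟨hWV ?_, ?_⟩, ?_⟩
    · rw [PiNat.mem_cylinder_iff] at hεW ⊢
      intro i hi
      simp [splice, hi, hεW i hi]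
    · rw [Set.mem_ofPred_eq, digitValue_splice h0 h1, hη, ← digitValue_eq_add h0 h1]
      exact hε
    · intro h
      apply hne
      funext i
      simpa [splice] using congrFun h (i + n)
  obtain ⟨ε, hε⟩ := hx
  obtain ⟨f, hf, -, hinj⟩ := hperf.exists_nat_bool_injection ⟨ε, hε.symm⟩
  refine hcard.not_ge ?_
  have := Cardinal.lift_mk_le_lift_mk_of_injective (f := fun b => (⟨f b, hf ⟨b, rfl⟩⟩ :
    {ε : ℕ → ι // x = digitValue a lam ε})) fun b₁ b₂ h => hinj (congrArg Subtype.val h)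
  simpa using this

lemma dimH_lt_continuum_le (h0 : 0 < lam) (h1 : lam < 1) :
    dimH {x | (∃ ε, digitValue a lam ε = x) ∧
      Cardinal.mk {ε : ℕ → ι // x = digitValue a lam ε} < Cardinal.continuum} ≤
    dimH {x | ∃! ε, digitValue a lam ε = x} := by
  set U := {x | ∃! ε, digitValue a lam ε = x}
  have hsub : {x | (∃ ε, digitValue a lam ε = x) ∧
      Cardinal.mk {ε : ℕ → ι // x = digitValue a lam ε} < Cardinal.continuum} ⊆
      ⋃ w : Σ n : ℕ, Fin n → ι,
        (fun y => ∑ i, a (w.2 i) * lam ^ ((i : ℕ) + 1) + lam ^ w.1 * y) '' U := by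
    rintro x ⟨hx, hcard⟩
    obtain ⟨n, ε, hε, hu⟩ := exists_tail_existsUnique h0 h1 hx hcard
    refine Set.mem_iUnion.2 ⟨⟨n, fun i => ε i⟩, _, hu, ?_⟩
    rw [← hε, digitValue_eq_add h0 h1 n ε, Finset.sum_range]
  refine (dimH_mono hsub).trans ?_
  rw [dimH_iUnion]
  refine iSup_le fun w => LipschitzWith.dimH_image_le (K := ‖lam ^ w.1‖₊) ?_ U
  refine LipschitzWith.of_dist_le_mul fun y z => ?_
  simp [Real.dist_eq, ← mul_sub, abs_mul]

end DigitValue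

/-- If every point of `[L, R]` is the value `λ (a_j + y)` of a digit `j` and some `y ∈ [L, R]`,
then every point of `[L, R]` has an expansion. -/
lemma exists_digitValue_eq {ι : Type*} {a : ι → ℝ} {lam L R : ℝ} (h0 : 0 < lam) (h1 : lam < 1)
    (hstep : ∀ x ∈ Set.Icc L R, ∃ j, ∃ y ∈ Set.Icc L R, x = lam * (a j + y))
    {x : ℝ} (hx : x ∈ Set.Icc L R) : ∃ ε, digitValue a lam ε = x := by
  choose j g hg hjg using fun z : Set.Icc L R => hstep z z.2
  let T : Set.Icc L R → Set.Icc L R := fun z => ⟨g z, hg z⟩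
  let orb : ℕ → Set.Icc L R := fun n => T^[n] ⟨x, hx⟩
  have hpart (n : ℕ) :
      ∑ i ∈ Finset.range n, a (j (orb i)) * lam ^ (i + 1) = x - lam ^ n * orb n := by
    induction n with
    | zero => simp [orb]
    | succ n ih =>
      have hn : (orb n : ℝ) = lam * (a (j (orb n)) + orb (n + 1)) := by
        simpa only [orb, Function.iterate_succ_apply'] using hjg (orb n)
      rw [Finset.sum_range_succ, ih]
      linear_combination (-lam ^ n) * hn
  have hdiff (i : ℕ) : a (j (orb i)) = orb i / lam - orb (i + 1) := by
    have hn : (orb i : ℝ) = lam * (a (j (orb i)) + orb (i + 1)) := by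
      simpa only [orb, Function.iterate_succ_apply'] using hjg (orb i)
    rw [hn]
    field_simp
    ring
  have hbd (n : ℕ) : |(orb n : ℝ)| ≤ max |L| |R| := abs_le_max_abs_abs (orb n).2.1 (orb n).2.2
  have hsum : Summable fun n : ℕ => a (j (orb n)) * lam ^ (n + 1) := by
    refine Summable.of_norm_bounded (g := fun n : ℕ =>
      (max |L| |R| / lam + max |L| |R|) * lam ^ (n + 1))
      (((summable_nat_add_iff 1).2 (summable_geometric_of_lt_one h0.le h1)).mul_left _) ?_
    intro n
    rw [norm_mul, Real.norm_of_nonneg (pow_nonneg h0.le _), hdiff]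
    gcongr
    refine (norm_sub_le _ _).trans ?_
    rw [Real.norm_eq_abs, Real.norm_eq_abs, abs_div, abs_of_pos h0]
    gcongr <;> apply hbd
  have hlim : Filter.Tendsto (fun n : ℕ => x - lam ^ n * orb n) Filter.atTop (nhds x) := by
    have : Filter.Tendsto (fun n : ℕ => lam ^ n * (orb n : ℝ)) Filter.atTop (nhds 0) :=
      (tendsto_pow_atTop_nhds_zero_of_lt_one h0.le h1).zero_mul_isBoundedUnder_le
        (Filter.isBoundedUnder_of ⟨max |L| |R|, hbd⟩)
    simpa using this.const_sub x
  refine ⟨fun n => j (orb n), tendsto_nhds_unique hsum.hasSum.tendsto_sum_nat ?_⟩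
  simpa only [hpart] using hlim

lemma digitValue_mem_Icc {ι : Type*} [Finite ι] {a : ι → ℝ} {lam b t : ℝ} (h0 : 0 < lam)
    (h1 : lam < 1) (hab : ∀ i, a i ∈ Set.Icc b t) (ε : ℕ → ι) :
    digitValue a lam ε ∈ Set.Icc (lam * b / (1 - lam)) (lam * t / (1 - lam)) := by
  have hg (b : ℝ) : HasSum (fun n : ℕ => b * lam ^ (n + 1)) (lam * b / (1 - lam)) := by
    have h := (hasSum_geometric_of_lt_one h0.le h1).mul_left (b * lam)
    rw [show lam * b / (1 - lam) = b * lam * (1 - lam)⁻¹ by ring]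
    exact h.congr_fun fun n => by ring
  have hε := (summable_digits (a := a) h0 h1 ε).hasSum
  refine ⟨hasSum_le (fun n => ?_) (hg b) hε, hasSum_le (fun n => ?_) hε (hg t)⟩
  · exact mul_le_mul_of_nonneg_right (hab _).1 (pow_nonneg h0.le _)
  · exact mul_le_mul_of_nonneg_right (hab _).2 (pow_nonneg h0.le _)

/-- If consecutive digits differ by at most `R - L`, then the intervals `λ (a_j + [L, R])` with
`j ≤ n` cover the interval from `λ (a_0 + L)` to `λ (a_n + R)`. -/
lemma exists_digit_step {m : ℕ} (hm : 0 < m) {a : Fin m → ℝ} {lam L R : ℝ} (h0 : 0 < lam)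
    (hgap : ∀ j : ℕ, (hj : j + 1 < m) → a ⟨j + 1, hj⟩ - a ⟨j, Nat.lt_of_succ_lt hj⟩ ≤ R - L)
    {x : ℝ} (hL : lam * (a ⟨0, hm⟩ + L) ≤ x) (n : ℕ) (hn : n < m)
    (hR : x ≤ lam * (a ⟨n, hn⟩ + R)) :
    ∃ j, ∃ y ∈ Set.Icc L R, x = lam * (a j + y) := by
  have hin (j : Fin m) (hl : lam * (a j + L) ≤ x) (hr : x ≤ lam * (a j + R)) :
      ∃ j, ∃ y ∈ Set.Icc L R, x = lam * (a j + y) := by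
    refine ⟨j, x / lam - a j, ⟨?_, ?_⟩, by field_simp; ring⟩
    · rw [le_sub_iff_add_le, le_div_iff₀ h0]; linarith
    · rw [sub_le_iff_le_add, div_le_iff₀ h0]; linarith
  induction n with
  | zero => exact hin _ hL hR
  | succ n ih =>
    rcases le_total (lam * (a ⟨n + 1, hn⟩ + L)) x with h | h
    · exact hin _ h hR
    · exact ih (by omega) (h.trans (by have := hgap n hn; gcongr lam * ?_; linarith))

/-- Under Pedicini's condition, the set of `x ∈ (λa_1/(1−λ), λa_m/(1−λ))`
having fewer than a continuum of expansions `x = ∑_{n≥1} ε_n λ^n` with digits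
in `{a_1,…,a_m}` has Hausdorff dimension `< 1`; in particular Lebesgue-a.e.
`x` in this interval has a continuum of such expansions. -/
theorem stmt13 (m : ℕ) (hm : 2 ≤ m) (a : Fin m → ℝ) (ha : StrictMono a)
    (lam : ℝ) (h0 : 0 < lam) (h1 : lam < 1)
    (hped : ∀ j : ℕ, (hj : j + 1 < m) →
      a ⟨j + 1, hj⟩ - a ⟨j, by omega⟩ <
        lam * (a ⟨m - 1, by omega⟩ - a ⟨0, by omega⟩) / (1 - lam)) :
    dimH {x ∈ Set.Ioo (lam * a ⟨0, by omega⟩ / (1 - lam))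
        (lam * a ⟨m - 1, by omega⟩ / (1 - lam)) |
        Cardinal.mk {ε : ℕ → Fin m //
          x = ∑' n : ℕ, a (ε n) * lam ^ (n + 1)} < Cardinal.continuum} < 1 ∧
    ∀ᵐ x ∂(volume : Measure ℝ),
      x ∈ Set.Ioo (lam * a ⟨0, by omega⟩ / (1 - lam))
        (lam * a ⟨m - 1, by omega⟩ / (1 - lam)) →
      Cardinal.mk {ε : ℕ → Fin m //
        x = ∑' n : ℕ, a (ε n) * lam ^ (n + 1)} = Cardinal.continuum := by
  set a0 := a ⟨0, by omega⟩
  set aM := a ⟨m - 1, by omega⟩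
  set L := lam * a0 / (1 - lam) with hL
  set R := lam * aM / (1 - lam) with hR
  have h1' : 0 < 1 - lam := by linarith
  have hRL : lam * (aM - a0) / (1 - lam) = R - L := by rw [hL, hR]; ring
  have hped' (j : ℕ) (hj : j + 1 < m) : a ⟨j + 1, hj⟩ - a ⟨j, by omega⟩ < R - L :=
    (hped j hj).trans_eq hRL
  have hLfix : lam * (a0 + L) = L := by rw [hL]; field_simp; ring
  have hRfix : lam * (aM + R) = R := by rw [hR]; field_simp; ring
  have hmem (ε) : digitValue a lam ε ∈ Set.Icc L R := by
    refine digitValue_mem_Icc h0 h1 (fun i => ⟨?_, ?_⟩) ε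
    · exact ha.monotone (Fin.mk_le_of_le_val (Nat.zero_le _))
    · exact ha.monotone (Fin.le_def.2 (Nat.le_sub_one_of_lt i.2))
  have hsurj {x : ℝ} (hx : x ∈ Set.Icc L R) : ∃ ε, digitValue a lam ε = x :=
    exists_digitValue_eq h0 h1 (fun x hx => exists_digit_step (by omega) h0
      (fun j hj => (hped' j hj).le) (hLfix.trans_le hx.1) (m - 1) (by omega)
      (hx.2.trans_eq hRfix.symm)) hx
  set a1 := a ⟨1, by omega⟩
  have hgap : a1 - a0 < R - L := hped' 0 (by omega)
  have h01 : a0 < a1 := ha (Fin.mk_lt_mk.2 Nat.zero_lt_one)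
  have h1M : a1 ≤ aM := ha.monotone (Fin.mk_le_mk.2 (by omega))
  have hunique : dimH {x | ∃! ε, digitValue a lam ε = x} < 1 := by
    have hprepend (j : Fin m) {y : ℝ} (hl : lam * (a j + L) ≤ y) (hr : y ≤ lam * (a j + R)) :
        ∃ η : ℕ → Fin m, η 0 = j ∧ digitValue a lam η = y := by
      obtain ⟨η, hη⟩ := hsurj (x := y / lam - a j) ⟨by
        rw [le_sub_iff_add_le, le_div_iff₀ h0]; linarith, by
        rw [sub_le_iff_le_add, div_le_iff₀ h0]; linarith⟩
      refine ⟨splice 1 (fun _ => j) η, by simp [splice], ?_⟩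
      rw [digitValue_splice h0 h1, hη]
      simp
      field_simp
      ring
    have hpc : lam * (a1 + L) + lam * (R - L - (a1 - a0)) = lam * (a0 + R) := by ring
    refine dimH_existsUnique_lt_one (p := lam * (a1 + L)) (c := lam * (R - L - (a1 - a0)))
      h0 h1 hmem (mul_pos h0 (by linarith)) ?_ ?_ ?_
    · exact hLfix.ge.trans (by gcongr)
    · have h0M : a0 ≤ aM := h01.le.trans h1M
      exact hpc.trans_le (le_trans (by gcongr) hRfix.le)
    · intro y hy
      rw [hpc] at hy
      obtain ⟨η₁, e₁, h₁⟩ := hprepend ⟨0, by omega⟩ (y := y)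
        (le_trans (by gcongr) hy.1) hy.2
      obtain ⟨η₂, e₂, h₂⟩ := hprepend ⟨1, by omega⟩ (y := y)
        hy.1 (hy.2.trans (by gcongr))
      refine ⟨η₁, η₂, fun h => ?_, h₁, h₂⟩
      rw [h, e₂] at e₁
      simp at e₁
  set B := {x ∈ Set.Ioo L R | Cardinal.mk {ε : ℕ → Fin m //
    x = ∑' n : ℕ, a (ε n) * lam ^ (n + 1)} < Cardinal.continuum}
  have hB : dimH B < 1 := by
    refine lt_of_le_of_lt ((dimH_mono ?_).trans (dimH_lt_continuum_le h0 h1)) hunique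
    exact fun x hx => ⟨hsurj (Set.Ioo_subset_Icc_self hx.1), hx.2⟩
  refine ⟨hB, ?_⟩
  have hvol : volume B = 0 := by
    have := hausdorffMeasure_of_dimH_lt (d := 1) (s := B) (by simpa using hB)
    rwa [NNReal.coe_one, hausdorffMeasure_real] at this
  filter_upwards [measure_eq_zero_iff_ae_notMem.1 hvol] with x hxB hx
  refine le_antisymm ((Cardinal.mk_subtype_le _).trans ?_) (not_lt.1 fun h => hxB ⟨hx, h⟩)
  have : Cardinal.mk (ℕ → Fin m) ≤ Cardinal.aleph0 ^ Cardinal.aleph0 := by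
    simpa using Cardinal.power_le_power_right (c := Cardinal.aleph0)
      (Cardinal.natCast_lt_aleph0 (n := m)).le
  simpa using this
end
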